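/- arXiv:1506.05649 — 3 statements merged into one kernel-verified Lean document; each statement's English description precedes it below -/
import Mathlib

section
/- Assume the Littlewood conjecture: for all α, β ∈ ℝ, liminf_{n→∞} n‖nα‖‖nβ‖ = 0, where n ranges over positive integers. Then: (i) for all integers k > d ≥ 1 with (k,d) ≠ (2,1), there is no k to d canonical cut and project set which is LR with respect to ℛ_d; and (ii) for every d ≥ 1 and every integer k > d with k ≠ 2d, there is no k to d canonical cut and project set which is LR_Ω with respect to ℛ_d. -/
noncomputable section

open MeasureTheory Set Filter

/-- The distance from a real number to the nearest integer. -/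
def distInt (x : ℝ) : ℝ := |x - round x|

/-- The real vector in `ℝ^k` corresponding to an integer vector. -/
def intVec {k : ℕ} (n : Fin k → ℤ) : Fin k → ℝ := fun i => (n i : ℝ)

/-- The embedding of `ℝ^d` into `ℝ^k` as the span of the first `d` coordinates. -/
def emb (k d : ℕ) (x : Fin d → ℝ) : Fin k → ℝ :=
  fun i => if h : (i : ℕ) < d then x ⟨i, h⟩ else 0

/-- A `k` to `d` cut and project scheme: a totally irrational `d`-dimensional subspace
`E ⊆ ℝ^k`, the projection `proj = π` onto `E` along a complementary subspace `F_π`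
(injective on `ℤ^k`), the projection `rho = ρ` onto `E` with respect to the decomposition
`ℝ^k = E + F_ρ` where `F_ρ = {0} × ℝ^{k-d}`, a window `W ⊆ F_ρ`, and a point `s`
(a representative of a point of `ℝ^k/ℤ^k`). -/
structure CPS (k d : ℕ) where
  E : Submodule ℝ (Fin k → ℝ)
  rank_E : Module.finrank ℝ E = d
  /-- `E` is totally irrational: its image in `ℝ^k/ℤ^k` is dense,
  equivalently `E + ℤ^k` is dense in `ℝ^k`. -/
  totallyIrrational : Dense {x : Fin k → ℝ | ∃ e ∈ E, ∃ n : Fin k → ℤ, x = e + intVec n}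
  /-- `π`, the projection onto `E` along a complementary subspace `F_π = ker proj`. -/
  proj : (Fin k → ℝ) →ₗ[ℝ] (Fin k → ℝ)
  proj_mem : ∀ x, proj x ∈ E
  proj_id : ∀ x ∈ E, proj x = x
  /-- `π` is injective on `ℤ^k`. -/
  proj_inj : ∀ m n : Fin k → ℤ, proj (intVec m) = proj (intVec n) → m = n
  /-- `ρ`, the projection onto `E` with respect to the decomposition `ℝ^k = E + F_ρ`. -/
  rho : (Fin k → ℝ) →ₗ[ℝ] (Fin k → ℝ)
  rho_mem : ∀ x, rho x ∈ E
  /-- `x - ρ(x) ∈ F_ρ = {0} × ℝ^{k-d}`; in particular `ρ* = id - ρ` maps into `F_ρ`. -/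
  rho_decomp : ∀ (x : Fin k → ℝ) (i : Fin k), (i : ℕ) < d → x i - rho x i = 0
  /-- The window `W ⊆ F_ρ`. -/
  window : Set (Fin k → ℝ)
  window_sub : ∀ x ∈ window, ∀ i : Fin k, (i : ℕ) < d → x i = 0
  /-- A representative of the point `s ∈ ℝ^k/ℤ^k`. -/
  s : Fin k → ℝ

namespace CPS

variable {k d : ℕ} (𝒟 : CPS k d)

/-- `ρ* : ℝ^k → F_ρ`, the projection onto `F_ρ` along `E`. -/
def rhoStar (x : Fin k → ℝ) : Fin k → ℝ := x - 𝒟.rho x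

/-- The strip `S = W + E`. -/
def strip : Set (Fin k → ℝ) := {z | ∃ w ∈ 𝒟.window, ∃ e ∈ (𝒟.E : Set (Fin k → ℝ)), z = w + e}

/-- The cut and project set `Y = π(S ∩ (ℤ^k + s))`. -/
def Y : Set (Fin k → ℝ) :=
  𝒟.proj '' (𝒟.strip ∩ {z | ∃ n : Fin k → ℤ, z = intVec n + 𝒟.s})

/-- `s` is regular: `ℤ^k + s` does not meet the boundary of the strip. -/
def Regular : Prop := ∀ n : Fin k → ℤ, intVec n + 𝒟.s ∉ frontier 𝒟.strip

/-- `Y` is aperiodic: its group of periods is trivial. -/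
def Aperiodic : Prop := ∀ x ∈ (𝒟.E : Set (Fin k → ℝ)),
  {z | ∃ y ∈ 𝒟.Y, z = y + x} = 𝒟.Y → x = 0

/-- The window is the cubical window `{Σ_{i=d+1}^k t_i e_i : 0 ≤ t_i < 1}`. -/
def IsCubical : Prop :=
  𝒟.window = {x : Fin k → ℝ | ∀ i : Fin k,
    if (i : ℕ) < d then x i = 0 else 0 ≤ x i ∧ x i < 1}

/-- The window is the canonical window `ρ*([0,1]^k)`. -/
def IsCanonical : Prop :=
  𝒟.window = 𝒟.rhoStar '' {x : Fin k → ℝ | ∀ i, x i ∈ Icc (0 : ℝ) 1}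

/-- `Y` is a cubical cut and project set: totally irrational (a field of `CPS`),
regular, aperiodic, and formed with the cubical window. -/
def IsCubicalCPSet : Prop := 𝒟.IsCubical ∧ 𝒟.Regular ∧ 𝒟.Aperiodic

/-- `Y` is a canonical cut and project set. -/
def IsCanonicalCPSet : Prop := 𝒟.IsCanonical ∧ 𝒟.Regular ∧ 𝒟.Aperiodic

/-- For `y ∈ Y`, the (unique, by injectivity of `π` on `ℤ^k`) integer vector `ỹ`
with `ỹ + s ∈ S` and `π(ỹ + s) = y`. -/
def intRep (y : Fin k → ℝ) : Fin k → ℤ :=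
  Classical.epsilon fun n : Fin k → ℤ =>
    intVec n + 𝒟.s ∈ 𝒟.strip ∧ 𝒟.proj (intVec n + 𝒟.s) = y

/-- The patch of shape `Ω` at `y`: `P(y,Ω) = {y' ∈ Y : ρ(ỹ' - ỹ) ∈ ρ(Ω)}`,
where `Ω ⊆ ℝ^d` is viewed inside `⟨e₁,…,e_d⟩_ℝ ⊆ ℝ^k`. -/
def patch (Ω : Set (Fin d → ℝ)) (y : Fin k → ℝ) : Set (Fin k → ℝ) :=
  {y' | y' ∈ 𝒟.Y ∧
    𝒟.rho (intVec (𝒟.intRep y') - intVec (𝒟.intRep y)) ∈ 𝒟.rho '' (emb k d '' Ω)}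

/-- Two patches of shape `Ω` are equivalent if they agree up to the translation
taking one distinguished point to the other. -/
def PatchEquiv (Ω : Set (Fin d → ℝ)) (y₁ y₂ : Fin k → ℝ) : Prop :=
  𝒟.patch Ω y₁ = {z | ∃ w ∈ 𝒟.patch Ω y₂, z = w + (y₁ - y₂)}

/-- The pattern (equivalence class) of the patch of shape `Ω` at `y` occurs in the
region `R ⊆ E`: some point `y' ∈ Y ∩ R` has patch equivalent to that at `y`. -/
def OccursIn (Ω : Set (Fin d → ℝ)) (y : Fin k → ℝ) (R : Set (Fin k → ℝ)) : Prop :=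
  ∃ y' ∈ 𝒟.Y ∩ R, 𝒟.PatchEquiv Ω y' y

/-- `Y` is linearly repetitive with respect to a collection `𝒜` of shapes in `ℝ^d`:
there is `C > 0` such that for every `Ω ∈ 𝒜`, every pattern of shape `Ω` occurring in
`Y` occurs in every ball in `E` of volume `C·|Ω|` (balls in `E` being images under the
identification `ρ ∘ emb : ℝ^d ≅ E` of balls in `ℝ^d`). -/
def IsLR (𝒜 : Set (Set (Fin d → ℝ))) : Prop :=
  ∃ C > (0 : ℝ), ∀ Ω ∈ 𝒜, ∀ y ∈ 𝒟.Y, ∀ (x : Fin d → ℝ) (r : ℝ),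
    volume (Metric.closedBall x r) = ENNReal.ofReal C * volume Ω →
    𝒟.OccursIn Ω y (𝒟.rho '' (emb k d '' Metric.closedBall x r))

/-- `Y` is `LR_Ω` with respect to a collection `𝒜` of shapes in `ℝ^d`: there is `C > 0`
such that for every `Ω ∈ 𝒜`, every pattern of shape `Ω` occurring in `Y` occurs in every
translate of `C·Ω`. -/
def IsLROmega (𝒜 : Set (Set (Fin d → ℝ))) : Prop :=
  ∃ C > (0 : ℝ), ∀ Ω ∈ 𝒜, ∀ y ∈ 𝒟.Y, ∀ x : Fin d → ℝ,
    𝒟.OccursIn Ω y (𝒟.rho '' (emb k d '' {z | ∃ w ∈ Ω, z = x + C • w}))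

end CPS

/-- `ℛ_d`: aligned rectangles in `ℝ^d` with integer vertices and nonempty interior. -/
def RdCollection (d : ℕ) : Set (Set (Fin d → ℝ)) :=
  {Ω | ∃ a b : Fin d → ℤ, (∀ i, a i < b i) ∧
    Ω = {x : Fin d → ℝ | ∀ i, (a i : ℝ) ≤ x i ∧ x i ≤ (b i : ℝ)}}

/-- `𝒞_d`: convex polytopes in `ℝ^d` with vertices in `ℤ^d` and nonempty interior. -/
def CdCollection (d : ℕ) : Set (Set (Fin d → ℝ)) :=
  {Ω | (∃ V : Finset (Fin d → ℤ),
      Ω = convexHull ℝ ((fun n : Fin d → ℤ => intVec n) '' (V : Set (Fin d → ℤ)))) ∧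
    (interior Ω).Nonempty}


/-- The Littlewood hypothesis in epsilon form. -/
lemma littlewood_eps
    (littlewood : ∀ α β : ℝ,
      Filter.liminf
        (fun n : ℕ => (n : ℝ) * distInt ((n : ℝ) * α) * distInt ((n : ℝ) * β))
        Filter.atTop = 0) (α β : ℝ) {η : ℝ} (hη : 0 < η) :
    ∃ q : ℕ, 0 < q ∧ (q : ℝ) * distInt ((q : ℝ) * α) * distInt ((q : ℝ) * β) < η := by
  by_contra hcon
  push Not at hcon
  have h := littlewood α β
  set f := (fun n : ℕ => (n : ℝ) * distInt ((n : ℝ) * α) * distInt ((n : ℝ) * β)) with hf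
  have hd : ∀ x, distInt x ≤ 1/2 := fun x => abs_sub_round x
  have hd0 : ∀ x, 0 ≤ distInt x := fun x => abs_nonneg _
  have hev : ∀ᶠ n in atTop, η ≤ f n := by
    filter_upwards [eventually_gt_atTop 0] with n hn
    exact hcon n hn
  -- frequently bounded
  have hfreq : ∃ᶠ n in atTop, f n ≤ 1 := by
    by_cases hirr : Irrational α
    · have hinf := Real.infinite_rat_abs_sub_lt_one_div_den_sq_of_irrational hirr
      rw [Filter.frequently_atTop]
      intro a
      by_contra hno
      push Not at hno
      -- all denominators < a
      have hden : ∀ q ∈ {q : ℚ | |α - q| < 1 / (q.den : ℝ) ^ 2}, q.den < a := by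
        intro q hq
        by_contra hlt
        push Not at hlt
        have := hno q.den hlt
        have hq' : |α - q| < 1 / (q.den : ℝ) ^ 2 := hq
        have hdpos : (0:ℝ) < q.den := by exact_mod_cast q.den_pos
        have h1 : distInt ((q.den : ℝ) * α) ≤ 1 / q.den := by
          have := round_le ((q.den : ℝ) * α) q.num
          refine this.trans ?_
          have hqq : ((q:ℝ)) * q.den = q.num := by exact_mod_cast Rat.mul_den_eq_num q
          rw [← hqq, show (q.den : ℝ) * α - q * q.den = q.den * (α - q) by ring, abs_mul,
            abs_of_pos hdpos]
          calc (q.den:ℝ) * |α - q| ≤ q.den * (1 / (q.den : ℝ) ^ 2) := by gcongr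
            _ = 1 / q.den := by field_simp
        have h2 : f q.den ≤ 1 := by
          simp only [hf]
          calc (q.den:ℝ) * distInt ((q.den : ℝ) * α) * distInt ((q.den : ℝ) * β)
              ≤ q.den * (1 / q.den) * (1/2) := by
                gcongr
                · exact hd0 _
                · exact hd _
            _ ≤ 1 := by rw [mul_one_div_cancel hdpos.ne']; norm_num
        linarith
      apply hinf
      refine Set.Finite.subset (s := (fun p : ℤ × ℕ => (p.1 : ℚ) / p.2) ''
        ((Set.Icc (-(⌈(|α|+1) * a⌉)) (⌈(|α|+1) * a⌉)) ×ˢ (Set.Iio a))) ?_ ?_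
      · exact ((Set.finite_Icc _ _).prod (Set.finite_Iio _)).image _
      · intro q hq
        have hda := hden q hq
        have hq' : |α - q| < 1 / (q.den : ℝ) ^ 2 := hq
        refine ⟨(q.num, q.den), ⟨?_, hda⟩, Rat.num_div_den q⟩
        have hdpos : (1:ℝ) ≤ q.den := by exact_mod_cast q.den_pos
        have h3 : |(q:ℝ)| ≤ |α| + 1 := by
          have : 1 / (q.den : ℝ) ^ 2 ≤ 1 := by
            rw [div_le_one (by positivity)]; nlinarith
          have h4 := abs_sub_abs_le_abs_sub (q:ℝ) α
          rw [abs_sub_comm] at h4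
          linarith
        have hqq : ((q:ℝ)) * q.den = q.num := by exact_mod_cast Rat.mul_den_eq_num q
        have h5 : |(q.num : ℝ)| ≤ (|α|+1) * a := by
          rw [← hqq, abs_mul]
          have : |(q.den:ℝ)| ≤ a := by
            rw [abs_of_nonneg (by positivity)]; exact_mod_cast hda.le
          gcongr
        have h6 : ((|q.num| : ℤ) : ℝ) ≤ (⌈(|α|+1) * a⌉ : ℝ) := by
          push_cast
          exact h5.trans (Int.le_ceil _)
        have h7 : |q.num| ≤ ⌈(|α|+1) * a⌉ := by exact_mod_cast h6
        exact Set.mem_Icc.2 (abs_le.1 h7)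
    · simp only [Irrational, not_not] at hirr
      obtain ⟨r, rfl⟩ := hirr
      rw [Filter.frequently_atTop]
      intro a
      refine ⟨a * r.den, Nat.le_mul_of_pos_right _ r.den_pos, ?_⟩
      have : distInt (((a * r.den : ℕ) : ℝ) * (r:ℝ)) = 0 := by
        have hqq : ((r:ℝ)) * r.den = r.num := by exact_mod_cast Rat.mul_den_eq_num r
        have : ((a * r.den : ℕ) : ℝ) * (r:ℝ) = ((a * r.num : ℤ) : ℝ) := by
          push_cast; rw [← hqq]; ring
        rw [this, distInt, round_intCast]; simp
      simp only [hf, this]; simp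
  have hle : η ≤ liminf f atTop := by
    apply le_liminf_of_le
    · exact Filter.IsCoboundedUnder.of_frequently_le hfreq
    · exact hev
  rw [h] at hle
  linarith

/-- The dual form of the Littlewood conjecture. -/
lemma littlewood_dual
    (littlewood : ∀ α β : ℝ,
      Filter.liminf
        (fun n : ℕ => (n : ℝ) * distInt ((n : ℝ) * α) * distInt ((n : ℝ) * β))
        Filter.atTop = 0) (α β : ℝ) {ε : ℝ} (hε : 0 < ε) :
    ∃ (m n p : ℤ) (M N : ℕ), ¬ (m = 0 ∧ n = 0) ∧ 1 ≤ M ∧ 1 ≤ N ∧ |m| ≤ M ∧ |n| ≤ N ∧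
      (M : ℝ) * N * |m * α + n * β - p| < ε := by
  obtain ⟨q, hq, hlt⟩ := littlewood_eps littlewood α β (η := (ε/2)^2) (by positivity)
  have hqR : (0:ℝ) < q := by exact_mod_cast hq
  set a := round ((q:ℝ) * α) with ha
  set b := round ((q:ℝ) * β) with hb
  set θ₁ := distInt ((q:ℝ) * α) with h1
  set θ₂ := distInt ((q:ℝ) * β) with h2
  have h1' : θ₁ = |(q:ℝ) * α - a| := rfl
  have h2' : θ₂ = |(q:ℝ) * β - b| := rfl
  have hθ1 : 0 ≤ θ₁ := abs_nonneg _
  have hθ2 : 0 ≤ θ₂ := abs_nonneg _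
  by_cases c1 : q * θ₂ ≤ θ₁
  · refine ⟨0, q, b, 1, q, ?_, le_rfl, hq, by simp, by simp, ?_⟩
    · simp; omega
    · have : (q * θ₂)^2 < (ε/2)^2 := by nlinarith [mul_nonneg hqR.le hθ2]
      have := lt_of_pow_lt_pow_left₀ 2 (by positivity) this
      push_cast
      rw [zero_mul, zero_add, ← h2']
      linarith
  by_cases c2 : q * θ₁ ≤ θ₂
  · refine ⟨q, 0, a, q, 1, ?_, hq, le_rfl, by simp, by simp, ?_⟩
    · simp; omega
    · have : (q * θ₁)^2 < (ε/2)^2 := by nlinarith [mul_nonneg hqR.le hθ1]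
      have := lt_of_pow_lt_pow_left₀ 2 (by positivity) this
      push_cast
      rw [zero_mul, add_zero, ← h1']
      linarith
  push Not at c1 c2
  have p2 : 0 < θ₂ := by
    rcases hθ2.lt_or_eq with h | h
    · exact h
    · rw [← h] at c1; linarith
  have p1 : 0 < θ₁ := by
    rcases hθ1.lt_or_eq with h | h
    · exact h
    · rw [← h] at c2; linarith
  set x := Real.sqrt (q * θ₂ / θ₁) with hx
  set y := Real.sqrt (q * θ₁ / θ₂) with hy
  have hx2 : x * x = q * θ₂ / θ₁ := Real.mul_self_sqrt (by positivity)
  have hy2 : y * y = q * θ₁ / θ₂ := Real.mul_self_sqrt (by positivity)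
  have hx1 : 1 ≤ x := by
    rw [hx, Real.one_le_sqrt, one_le_div p1]; exact c1.le
  have hy1 : 1 ≤ y := by
    rw [hy, Real.one_le_sqrt, one_le_div p2]; exact c2.le
  have hxy : x * y = q := by
    rw [hx, hy, ← Real.sqrt_mul (by positivity)]
    rw [show q * θ₂ / θ₁ * (q * θ₁ / θ₂) = (q:ℝ)^2 by field_simp]
    exact Real.sqrt_sq hqR.le
  have hsum : x * θ₁ + y * θ₂ < ε := by
    have e1 : (x * θ₁)^2 = q * θ₁ * θ₂ := by
      rw [show (x * θ₁)^2 = (x*x) * θ₁^2 by ring, hx2]; field_simp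
    have e2 : (y * θ₂)^2 = q * θ₁ * θ₂ := by
      rw [show (y * θ₂)^2 = (y*y) * θ₂^2 by ring, hy2]; field_simp
    have := lt_of_pow_lt_pow_left₀ 2 (by positivity) (e1 ▸ hlt : (x * θ₁)^2 < (ε/2)^2)
    have := lt_of_pow_lt_pow_left₀ 2 (by positivity) (e2 ▸ hlt : (y * θ₂)^2 < (ε/2)^2)
    linarith
  set M := ⌊x⌋₊ with hM
  set N := ⌊y⌋₊ with hN
  have hM1 : 1 ≤ M := Nat.le_floor (by simpa using hx1)
  have hN1 : 1 ≤ N := Nat.le_floor (by simpa using hy1)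
  have hMx : (M:ℝ) ≤ x := Nat.floor_le (by linarith)
  have hNy : (N:ℝ) ≤ y := Nat.floor_le (by linarith)
  have hcard : q < (M + 1) * (N + 1) := by
    have : (q:ℝ) < (M+1) * (N+1) := by
      rw [← hxy]
      have := Nat.lt_floor_add_one x
      have := Nat.lt_floor_add_one y
      gcongr
    exact_mod_cast this
  have : NeZero q := ⟨hq.ne'⟩
  let F : Fin (M+1) × Fin (N+1) → ZMod q := fun u => ((u.1 : ℕ) : ZMod q) * (a : ZMod q) +
    ((u.2 : ℕ) : ZMod q) * (b : ZMod q)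
  obtain ⟨u, v, huv, hF⟩ := Fintype.exists_ne_map_eq_of_card_lt F (by simpa [ZMod.card] using hcard)
  set m : ℤ := (u.1 : ℕ) - (v.1 : ℕ) with hm
  set n : ℤ := (u.2 : ℕ) - (v.2 : ℕ) with hn
  have hmM : |m| ≤ M := by
    rw [abs_le]; have := u.1.2; have := v.1.2; omega
  have hnN : |n| ≤ N := by
    rw [abs_le]; have := u.2.2; have := v.2.2; omega
  have hdiv : (q:ℤ) ∣ m * a + n * b := by
    rw [← ZMod.intCast_zmod_eq_zero_iff_dvd (m * a + n * b) q]
    simp only [F] at hF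
    rw [hm, hn]; push_cast
    linear_combination hF
  obtain ⟨p, hp⟩ := hdiv
  refine ⟨m, n, p, M, N, ?_, hM1, hN1, hmM, hnN, ?_⟩
  · rintro ⟨hm0, hn0⟩
    apply huv
    ext <;> omega
  · have hpR : (m:ℝ) * a + n * b = q * p := by exact_mod_cast hp
    have key : q * |m * α + n * β - p| ≤ M * θ₁ + N * θ₂ := by
      calc q * |m * α + n * β - p| = |m * ((q:ℝ) * α - a) + n * (q * β - b)| := by
            rw [← abs_of_pos hqR, ← abs_mul, abs_of_pos hqR]; congr 1; linear_combination hpR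
        _ ≤ |m * ((q:ℝ) * α - a)| + |n * (q * β - b)| := abs_add_le _ _
        _ = |(m:ℝ)| * θ₁ + |(n:ℝ)| * θ₂ := by rw [abs_mul, abs_mul, h1', h2']
        _ ≤ _ := by
          have : |(m:ℝ)| ≤ M := by exact_mod_cast hmM
          have : |(n:ℝ)| ≤ N := by exact_mod_cast hnN
          gcongr
    calc (M:ℝ) * N * |m * α + n * β - p| ≤ (x * y) * |m * α + n * β - p| := by gcongr
      _ = q * |m * α + n * β - p| := by rw [hxy]
      _ ≤ M * θ₁ + N * θ₂ := key
      _ ≤ x * θ₁ + y * θ₂ := by gcongr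
      _ < ε := hsum

/-- Simultaneous Dirichlet with a uniform bound on the multiplier. -/
lemma simul_dirichlet (n : ℕ) : ∃ Q : ℕ, 1 ≤ Q ∧ ∀ θ : Fin n → ℝ, ∃ q : ℕ, 1 ≤ q ∧ q ≤ Q ∧
    ∃ b : Fin n → ℤ, ∀ i, |(b i : ℝ) - q * θ i| ≤ 1/16 := by
  refine ⟨17 ^ n, Nat.one_le_pow _ _ (by norm_num), fun θ => ?_⟩
  let F : Fin (17 ^ n + 1) → (Fin n → Fin 17) := fun q i =>
    ⟨⌊17 * Int.fract ((q:ℕ) * θ i)⌋₊, by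
      rw [Nat.floor_lt (by have := Int.fract_nonneg ((q:ℕ) * θ i); positivity)]
      have := Int.fract_lt_one ((q:ℕ) * θ i)
      push_cast; linarith⟩
  obtain ⟨u, v, huv, hF⟩ := Fintype.exists_ne_map_eq_of_card_lt F (by simp)
  wlog hlt : v < u generalizing u v
  · exact this v u huv.symm hF.symm (lt_of_le_of_ne (not_lt.1 hlt) huv)
  have hlt' : (v:ℕ) < u := hlt
  refine ⟨u - v, by omega, by have := u.2; omega, fun i => ⌊(u:ℕ) * θ i⌋ - ⌊(v:ℕ) * θ i⌋, ?_⟩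
  intro i
  have h := congrArg Fin.val (congrFun hF i)
  simp only [F] at h
  have a1 := Nat.floor_le (a := 17 * Int.fract ((u:ℕ) * θ i)) (by have := Int.fract_nonneg ((u:ℕ) * θ i); positivity)
  have a2 := Nat.lt_floor_add_one (17 * Int.fract ((u:ℕ) * θ i))
  have a3 := Nat.floor_le (a := 17 * Int.fract ((v:ℕ) * θ i)) (by have := Int.fract_nonneg ((v:ℕ) * θ i); positivity)
  have a4 := Nat.lt_floor_add_one (17 * Int.fract ((v:ℕ) * θ i))
  rw [h] at a1 a2
  have e1 := Int.floor_add_fract ((u:ℕ) * θ i)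
  have e2 := Int.floor_add_fract ((v:ℕ) * θ i)
  rw [Nat.cast_sub hlt'.le]
  push_cast
  rw [abs_le]
  constructor <;> nlinarith

/-- The internal-space coordinates of the integer vector `(a, b)`. -/
def sig {d n : ℕ} (α : Fin n → Fin d → ℝ) (a : Fin d → ℤ) (b : Fin n → ℤ) : Fin n → ℝ :=
  fun i => (b i : ℝ) - ∑ j, α i j * (a j : ℝ)

/-- The canonical window in coordinates. -/
def Win {d n : ℕ} (α : Fin n → Fin d → ℝ) : Set (Fin n → ℝ) :=
  {w | ∃ (x : Fin d → ℝ) (y : Fin n → ℝ), (∀ j, x j ∈ Icc (0:ℝ) 1) ∧ (∀ i, y i ∈ Icc (0:ℝ) 1) ∧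
    ∀ i, w i = y i - ∑ j, α i j * x j}

def DenseProp {d n : ℕ} (α : Fin n → Fin d → ℝ) : Prop :=
  ∀ (t : Fin n → ℝ) (ε : ℝ), 0 < ε → ∃ a b, ∀ i, |sig α a b i - t i| < ε

/-- Coordinate form of the repetitivity property. -/
def SearchProp {d n : ℕ} (α : Fin n → Fin d → ℝ) (t₀ : Fin n → ℝ)
    (R : (Fin d → ℕ) → Fin d → ℝ) : Prop :=
  ∀ N : Fin d → ℕ, (∀ j, 1 ≤ N j) → ∀ a₀ b₀, sig α a₀ b₀ + t₀ ∈ Win α →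
    ∀ a₁ b₁, sig α a₁ b₁ + t₀ ∈ Win α → ∃ a₂ b₂, sig α a₂ b₂ + t₀ ∈ Win α ∧
      (∀ j, |(a₂ j : ℝ) - a₁ j| ≤ R N j) ∧
      ∀ a b, (∀ j, |a j| ≤ (N j : ℤ)) → sig α (a₀ + a) (b₀ + b) + t₀ ∈ Win α →
        sig α (a₂ + a) (b₂ + b) + t₀ ∈ Win α

section core
variable {d n : ℕ} {α : Fin n → Fin d → ℝ} {t₀ : Fin n → ℝ} {R : (Fin d → ℕ) → Fin d → ℝ}

lemma sig_add (a a' : Fin d → ℤ) (b b' : Fin n → ℤ) :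
    sig α (a + a') (b + b') = sig α a b + sig α a' b' := by
  funext i
  simp only [sig, Pi.add_apply]
  push_cast
  simp only [mul_add, Finset.sum_add_distrib]
  ring

lemma sig_sub (a a' : Fin d → ℤ) (b b' : Fin n → ℤ) :
    sig α (a - a') (b - b') = sig α a b - sig α a' b' := by
  funext i
  simp only [sig, Pi.sub_apply]
  push_cast
  simp only [mul_sub, Finset.sum_sub_distrib]
  ring

lemma sig_smul (q : ℤ) (a : Fin d → ℤ) (b : Fin n → ℤ) :
    sig α (q • a) (q • b) = (q : ℝ) • sig α a b := by
  funext i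
  simp only [sig, Pi.smul_apply, smul_eq_mul]
  push_cast
  rw [mul_sub, Finset.mul_sum]
  congr 1
  exact Finset.sum_congr rfl fun j _ => by ring

def xt (α : Fin n → Fin d → ℝ) (i : Fin n) (j : Fin d) : ℤ := if α i j < 0 then 1 else 0

lemma xt_mem (i : Fin n) (j : Fin d) : (xt α i j : ℝ) ∈ Icc (0:ℝ) 1 := by
  unfold xt; split_ifs <;> simp

lemma win_le {w : Fin n → ℝ} (hw : w ∈ Win α) (i : Fin n) :
    w i ≤ 1 - ∑ j, α i j * (xt α i j : ℝ) := by
  obtain ⟨x, y, hx, hy, h⟩ := hw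
  rw [h i]
  have := (hy i).2
  have : ∑ j, α i j * (xt α i j : ℝ) ≤ ∑ j, α i j * x j := by
    apply Finset.sum_le_sum
    intro j _
    have h0 := (hx j).1
    have h1 := (hx j).2
    unfold xt
    split_ifs with hc
    · push_cast; nlinarith
    · push_cast; push Not at hc; nlinarith
  linarith

lemma le_win {w : Fin n → ℝ} (hw : w ∈ Win α) (i : Fin n) :
    0 - ∑ j, α i j * (1 - xt α i j : ℝ) ≤ w i := by
  obtain ⟨x, y, hx, hy, h⟩ := hw
  rw [h i]
  have := (hy i).1
  have : ∑ j, α i j * x j ≤ ∑ j, α i j * (1 - xt α i j : ℝ) := by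
    apply Finset.sum_le_sum
    intro j _
    have h0 := (hx j).1
    have h1 := (hx j).2
    unfold xt
    split_ifs with hc
    · push_cast; nlinarith
    · push_cast; push Not at hc; nlinarith
  linarith

lemma top_mem {i : Fin n} {z : Fin n → ℝ}
    (hz : ∀ l, |z l - ((if l = i then 1 else 1/2) - ∑ j, α l j * (xt α i j : ℝ))| ≤ 1/2)
    (hi : z i ≤ 1 - ∑ j, α i j * (xt α i j : ℝ)) : z ∈ Win α := by
  refine ⟨fun j => xt α i j, fun l => z l + ∑ j, α l j * (xt α i j : ℝ), fun j => xt_mem i j, ?_,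
    fun l => by ring⟩
  intro l
  have := abs_le.1 (hz l)
  by_cases hl : l = i
  · subst hl
    simp only [if_true] at this
    constructor <;> linarith
  · simp only [if_neg hl] at this
    constructor <;> linarith

lemma bot_mem {i : Fin n} {z : Fin n → ℝ}
    (hz : ∀ l, |z l - ((if l = i then 0 else 1/2) - ∑ j, α l j * (1 - xt α i j : ℝ))| ≤ 1/2)
    (hi : 0 - ∑ j, α i j * (1 - xt α i j : ℝ) ≤ z i) : z ∈ Win α := by
  refine ⟨fun j => 1 - xt α i j, fun l => z l + ∑ j, α l j * (1 - xt α i j : ℝ), fun j => ?_, ?_,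
    fun l => by ring⟩
  · have := xt_mem (α := α) i j
    constructor <;> linarith [this.1, this.2]
  intro l
  have := abs_le.1 (hz l)
  by_cases hl : l = i
  · subst hl
    simp only [if_true] at this
    constructor <;> linarith
  · simp only [if_neg hl] at this
    constructor <;> linarith

lemma cube_mem {z : Fin n → ℝ} (hz : ∀ l, z l ∈ Icc (0:ℝ) 1) : z ∈ Win α :=
  ⟨fun _ => 0, z, fun _ => by simp, hz, fun i => by simp⟩

lemma sig_v (i l : Fin n) :
    sig α (fun j => xt α i j - (1 - xt α i j)) (fun l => if l = i then 1 else 0) l =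
      ((if l = i then 1 else 1/2) - ∑ j, α l j * (xt α i j : ℝ)) -
      ((if l = i then 0 else 1/2) - ∑ j, α l j * (1 - xt α i j : ℝ)) := by
  simp only [sig]
  push_cast
  simp only [mul_sub, Finset.sum_sub_distrib]
  split_ifs <;> ring

lemma box_lemma (hD : DenseProp α) (hS : SearchProp α t₀ R) :
    ∃ K₀ : ℕ, ∀ (ga : Fin n → Fin d → ℤ) (gb : Fin n → Fin n → ℤ),
      (∀ i, 0 < sig α (ga i) (gb i) i) → (∀ i l, |sig α (ga i) (gb i) l| ≤ 1/16) →
      ∀ N : Fin d → ℕ, (∀ j, 1 ≤ N j) → (∀ i j, |ga i j| ≤ (N j : ℤ)) →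
      ∃ lo : Fin n → ℝ, ∀ a₁ b₁, sig α a₁ b₁ + t₀ ∈ Win α →
        ∃ a₂ b₂, sig α a₂ b₂ + t₀ ∈ Win α ∧
          (∀ j, |(a₂ j : ℝ) - a₁ j| ≤ R (fun j => N j + K₀) j) ∧
          ∀ i, lo i ≤ (sig α a₂ b₂ + t₀) i ∧
            (sig α a₂ b₂ + t₀) i ≤ lo i + sig α (ga i) (gb i) i := by
  have hp : ∀ i : Fin n, ∃ a b, ∀ l, |sig α a b l -
      (((if l = i then 1 else 1/2) - ∑ j, α l j * (xt α i j : ℝ)) - 1/2)| < 1/16 := fun i =>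
    hD (fun l => ((if l = i then 1 else 1/2) - ∑ j, α l j * (xt α i j : ℝ)) - 1/2) (1/16)
      (by norm_num)
  choose pa pb hpab using hp
  set va : Fin n → Fin d → ℤ := fun i j => xt α i j - (1 - xt α i j) with hva
  set vb : Fin n → Fin n → ℤ := fun i l => if l = i then 1 else 0 with hvb
  obtain ⟨K₀, hK₀⟩ : ∃ K₀ : ℕ, ∀ i j, |pa i j| ≤ (K₀:ℤ) ∧ |pa i j - va i j| ≤ (K₀:ℤ) := by
    refine ⟨∑ i, ∑ j, ((pa i j).natAbs + (pa i j - va i j).natAbs), fun i j => ?_⟩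
    have h1 : ((pa i j).natAbs + (pa i j - va i j).natAbs) ≤
        ∑ j, ((pa i j).natAbs + (pa i j - va i j).natAbs) :=
      Finset.single_le_sum (f := fun j => ((pa i j).natAbs + (pa i j - va i j).natAbs))
        (fun _ _ => Nat.zero_le _) (Finset.mem_univ j)
    have h2 : ∑ j, ((pa i j).natAbs + (pa i j - va i j).natAbs) ≤
        ∑ i, ∑ j, ((pa i j).natAbs + (pa i j - va i j).natAbs) :=
      Finset.single_le_sum (f := fun i => ∑ j, ((pa i j).natAbs + (pa i j - va i j).natAbs))
        (fun _ _ => Nat.zero_le _) (Finset.mem_univ i)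
    have h3 := h1.trans h2
    rw [Int.abs_eq_natAbs, Int.abs_eq_natAbs]
    constructor <;> exact_mod_cast (by omega)
  refine ⟨K₀, fun ga gb hpos hsm N hN hgN => ?_⟩
  set τ : Fin n → ℝ := fun i => sig α (ga i) (gb i) i with hτ
  set c : Fin n → ℝ := fun i => 1 - ∑ j, α i j * (xt α i j : ℝ) with hc
  set ws : Fin n → ℝ := fun i => c i - sig α (pa i) (pb i) i with hws
  have hws1 : ∀ i, |ws i - 1/2| < 1/16 := by
    intro i
    have := hpab i i
    simp only [if_true] at this
    rw [← abs_neg]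
    convert this using 2
    simp only [hws, hc]; ring
  -- choose the base point
  obtain ⟨μ, hμ0, hμ⟩ : ∃ μ : ℝ, 0 < μ ∧ ∀ i, μ ≤ τ i := by
    rcases isEmpty_or_nonempty (Fin n) with he | he
    · exact ⟨1, one_pos, fun i => he.elim i⟩
    · obtain ⟨i, hi⟩ := Finite.exists_min τ
      exact ⟨τ i, hpos i, hi⟩
  obtain ⟨a₀, b₀, h₀⟩ := hD (fun i => ws i - τ i / 2 - t₀ i) (μ / 2) (by positivity)
  set w₀ := sig α a₀ b₀ + t₀ with hw₀
  have hw0 : ∀ i, ws i - τ i < w₀ i ∧ w₀ i < ws i := by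
    intro i
    have := abs_lt.1 (h₀ i)
    have h2 := hμ i
    simp only [hw₀, Pi.add_apply]
    constructor <;> linarith
  have hτs : ∀ i, τ i ≤ 1/16 := fun i => (le_abs_self _).trans (hsm i i)
  have hw0h : ∀ i, |w₀ i - 1/2| ≤ 1/8 := by
    intro i
    have h1 := hw0 i
    have h2 := abs_lt.1 (hws1 i)
    have h3 := hτs i
    rw [abs_le]; constructor <;> linarith
  have hw0W : w₀ ∈ Win α := by
    apply cube_mem
    intro l
    have := abs_le.1 (hw0h l)
    constructor <;> linarith
  refine ⟨fun i => ws i - τ i, fun a₁ b₁ h₁ => ?_⟩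
  obtain ⟨a₂, b₂, hW, hR, hpat⟩ := hS (fun j => N j + K₀) (fun j => by have := hN j; omega)
    a₀ b₀ hw0W a₁ b₁ h₁
  refine ⟨a₂, b₂, hW, hR, fun i => ?_⟩
  have hup : sig α (a₂ + pa i) (b₂ + pb i) + t₀ ∈ Win α := by
    apply hpat
    · intro j
      have := (hK₀ i j).1
      push_cast
      have := hN j
      omega
    · rw [sig_add, add_right_comm]
      apply top_mem (i := i)
      · intro l
        have h1 := abs_lt.1 (hpab i l)
        have h2 := abs_le.1 (hw0h l)
        simp only [Pi.add_apply, ← hw₀] at *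
        rw [abs_le]; constructor <;> linarith
      · have := (hw0 i).2
        simp only [hws, hc] at this
        simp only [Pi.add_apply, ← hw₀] at *
        linarith
  have hdown : sig α (a₂ + (pa i - va i + ga i)) (b₂ + (pb i - vb i + gb i)) + t₀ ∈ Win α := by
    apply hpat
    · intro j
      have h1 := (hK₀ i j).2
      have h2 := hgN i j
      push_cast
      simp only [Pi.add_apply, Pi.sub_apply]
      rw [abs_le] at *
      omega
    · rw [sig_add, add_right_comm, sig_add, sig_sub]
      apply bot_mem (i := i)
      · intro l
        have h1 := abs_lt.1 (hpab i l)
        have h2 := abs_le.1 (hw0h l)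
        have h3 := abs_le.1 (hsm i l)
        have h4 := sig_v (α := α) i l
        simp only [Pi.add_apply, Pi.sub_apply, ← hw₀] at *
        rw [h4, abs_le]; constructor <;> linarith
      · have h1 := (hw0 i).1
        have h4 := sig_v (α := α) i i
        simp only [hws, hc, hτ] at h1
        simp only [Pi.add_apply, Pi.sub_apply, ← hw₀] at *
        rw [h4]
        simp only [if_true]
        linarith
  constructor
  · have h1 := le_win hdown i
    have h4 := sig_v (α := α) i i
    rw [sig_add, add_right_comm, sig_add, sig_sub] at h1
    simp only [Pi.add_apply, Pi.sub_apply] at h1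
    rw [h4] at h1
    simp only [if_true] at h1
    simp only [Pi.add_apply, hws, hc, hτ]
    linarith
  · have h1 := win_le hup i
    rw [sig_add, add_right_comm] at h1
    simp only [Pi.add_apply] at h1
    simp only [Pi.add_apply, hws, hc, hτ]
    linarith

end core

/-- Covering lemma. -/
lemma cover_lemma {ι : Type*} [Fintype ι] {T : Type*} (S : Finset T) (v : T → ι → ℝ)
    (lo τ : ι → ℝ) (hτ : ∀ i, 0 ≤ τ i)
    (h : ∀ x : ι → ℝ, (∀ i, x i ∈ Ioo (0:ℝ) 1) → ∀ ε > 0, ∃ w : ι → ℝ, (∀ i, |w i - x i| < ε) ∧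
      ∃ t ∈ S, ∀ i, lo i ≤ w i + v t i ∧ w i + v t i ≤ lo i + τ i) :
    1 ≤ (S.card : ℝ) * ∏ i, τ i := by
  set B : T → Set (ι → ℝ) := fun t => Set.Icc (lo - v t) (lo - v t + τ) with hB
  have hclosed : IsClosed (⋃ t ∈ S, B t) := by
    apply Set.Finite.isClosed_biUnion S.finite_toSet
    intro t _; exact isClosed_Icc
  have hsub : Set.univ.pi (fun _ : ι => Ioo (0:ℝ) 1) ⊆ ⋃ t ∈ S, B t := by
    intro x hx
    rw [← hclosed.closure_eq, Metric.mem_closure_iff]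
    intro ε hε
    obtain ⟨w, hw, t, ht, hwt⟩ := h x (fun i => hx i trivial) ε hε
    refine ⟨w, Set.mem_biUnion ht ?_, ?_⟩
    · constructor
      · intro i; have := (hwt i).1; simp only [Pi.sub_apply]; linarith
      · intro i; have := (hwt i).2; simp only [Pi.sub_apply, Pi.add_apply]; linarith
    · rw [dist_comm, dist_pi_lt_iff hε]; exact hw
  have h1 : volume (Set.univ.pi (fun _ : ι => Ioo (0:ℝ) 1)) = 1 := by
    rw [volume_pi_pi]; simp
  have h2 : ∀ t, volume (B t) = ENNReal.ofReal (∏ i, τ i) := by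
    intro t
    rw [hB]; simp only
    rw [Real.volume_Icc_pi, ENNReal.ofReal_prod_of_nonneg (fun i _ => hτ i)]
    congr 1; funext i; congr 1; simp
  have h3 : (1 : ENNReal) ≤ S.card * ENNReal.ofReal (∏ i, τ i) := by
    calc (1 : ENNReal) = _ := h1.symm
      _ ≤ volume (⋃ t ∈ S, B t) := measure_mono hsub
      _ ≤ ∑ t ∈ S, volume (B t) := measure_biUnion_finset_le _ _
      _ = _ := by simp [h2]
  have hp : 0 ≤ ∏ i, τ i := Finset.prod_nonneg fun i _ => hτ i
  rw [← ENNReal.ofReal_natCast, ← ENNReal.ofReal_mul (by positivity), ← ENNReal.ofReal_one,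
    ENNReal.ofReal_le_ofReal_iff (by positivity)] at h3
  exact h3

section core2
variable {d n : ℕ} {α : Fin n → Fin d → ℝ} {t₀ : Fin n → ℝ} {R : (Fin d → ℕ) → Fin d → ℝ}

lemma win_bound (α : Fin n → Fin d → ℝ) :
    ∃ B : ℕ, ∀ w ∈ Win α, ∀ w' ∈ Win α, ∀ i, |w i - w' i| ≤ B := by
  set D : Fin n → ℝ := fun i => (1 - ∑ j, α i j * (xt α i j : ℝ)) -
    (0 - ∑ j, α i j * (1 - xt α i j : ℝ)) with hD
  refine ⟨⌈∑ i, |D i|⌉₊, fun w hw w' hw' i => ?_⟩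
  have h1 : |D i| ≤ ∑ i, |D i| :=
    Finset.single_le_sum (f := fun i => |D i|) (fun _ _ => abs_nonneg _) (Finset.mem_univ i)
  have h2 := Nat.le_ceil (∑ i, |D i|)
  have h3 : D i ≤ |D i| := le_abs_self _
  have := win_le hw i
  have := win_le hw' i
  have := le_win hw i
  have := le_win hw' i
  simp only [hD] at *
  rw [abs_le]; constructor <;> linarith

lemma vol_lemma (hD : DenseProp α) (hS : SearchProp α t₀ R)
    (hR1 : ∀ N, (∀ j, 1 ≤ N j) → ∀ j, 1 ≤ R N j) :
    ∃ K₀ : ℕ, ∃ K₁ : ℝ, 0 < K₁ ∧ ∀ (ga : Fin n → Fin d → ℤ) (gb : Fin n → Fin n → ℤ),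
      (∀ i, 0 < sig α (ga i) (gb i) i) → (∀ i l, |sig α (ga i) (gb i) l| ≤ 1/16) →
      ∀ N : Fin d → ℕ, (∀ j, 1 ≤ N j) → (∀ i j, |ga i j| ≤ (N j : ℤ)) →
      1 ≤ K₁ * (∏ j, R (fun j => N j + K₀) j) * ∏ i, sig α (ga i) (gb i) i := by
  obtain ⟨K₀, hK₀⟩ := box_lemma hD hS
  obtain ⟨B, hB⟩ := win_bound α
  refine ⟨K₀, 3 ^ d * (2 * B + 3) ^ n, by positivity, fun ga gb hpos hsm N hN hgN => ?_⟩
  obtain ⟨lo, hlo⟩ := hK₀ ga gb hpos hsm N hN hgN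
  set r := R (fun j => N j + K₀) with hr
  have hr1 : ∀ j, 1 ≤ r j := hR1 _ (fun j => by have := hN j; omega)
  set S : Finset ((Fin d → ℤ) × (Fin n → ℤ)) :=
    (Fintype.piFinset fun j => Finset.Icc (-⌊r j⌋) ⌊r j⌋) ×ˢ
    (Fintype.piFinset fun _ => Finset.Icc (-((B:ℤ)+1)) ((B:ℤ)+1)) with hSdef
  have hcov := cover_lemma S (fun p => sig α p.1 (fun i => ⌊∑ j, α i j * (p.1 j : ℝ)⌋ + p.2 i))
    lo (fun i => sig α (ga i) (gb i) i) (fun i => (hpos i).le) (by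
      intro x hx ε hε
      obtain ⟨μ, hμ0, hμ⟩ : ∃ μ : ℝ, 0 < μ ∧ ∀ i, μ ≤ x i ∧ μ ≤ 1 - x i := by
        rcases isEmpty_or_nonempty (Fin n) with he | he
        · exact ⟨1, one_pos, fun i => he.elim i⟩
        · obtain ⟨i, hi⟩ := Finite.exists_min (fun i => min (x i) (1 - x i))
          refine ⟨min (x i) (1 - x i), ?_, fun l => ?_⟩
          · have := hx i
            exact lt_min this.1 (by linarith [this.2])
          · exact le_min_iff.1 (hi l)
      obtain ⟨a₁, b₁, h₁⟩ := hD (fun i => x i - t₀ i) (min ε μ) (lt_min hε hμ0)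
      have h1W : sig α a₁ b₁ + t₀ ∈ Win α := by
        apply cube_mem
        intro l
        have h1 := abs_lt.1 ((h₁ l).trans_le (min_le_right _ _))
        have h2 := hμ l
        simp only [Pi.add_apply]
        constructor <;> linarith
      obtain ⟨a₂, b₂, hW, hRR, hbox⟩ := hlo a₁ b₁ h1W
      refine ⟨sig α a₁ b₁ + t₀, ?_, (a₂ - a₁, fun i => (b₂ - b₁) i -
        ⌊∑ j, α i j * ((a₂ - a₁) j : ℝ)⌋), ?_, ?_⟩
      · intro i
        have := (h₁ i).trans_le (min_le_left _ _)
        have e : (sig α a₁ b₁ + t₀) i - x i = sig α a₁ b₁ i - (x i - t₀ i) := by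
          simp only [Pi.add_apply]; ring
        rw [e]; exact this
      · simp only [hSdef, Finset.mem_product, Fintype.mem_piFinset, Finset.mem_Icc]
        constructor
        · intro j
          have h1 := abs_le.1 (hRR j)
          rw [← abs_le]
          have h2 : |((a₂ - a₁) j : ℤ)| ≤ ⌊r j⌋ := by
            rw [Int.le_floor]; push_cast
            simpa using hRR j
          exact h2
        · intro i
          have h1 := hB _ hW _ h1W i
          have h2 : (sig α a₂ b₂ + t₀) i - (sig α a₁ b₁ + t₀) i =
            sig α (a₂ - a₁) (b₂ - b₁) i := by rw [sig_sub]; simp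
          rw [h2] at h1
          have h1 := abs_le.1 h1
          simp only [sig] at h1
          have f1 := Int.floor_le (∑ j, α i j * ((a₂ - a₁) j : ℝ))
          have f2 := Int.lt_floor_add_one (∑ j, α i j * ((a₂ - a₁) j : ℝ))
          set fl := ⌊∑ j, α i j * ((a₂ - a₁) j : ℝ)⌋ with hfl
          constructor
          · have : (-((B:ℝ)+1)) ≤ (((b₂ - b₁) i - fl : ℤ):ℝ) := by push_cast; linarith
            exact_mod_cast this
          · have : (((b₂ - b₁) i - fl : ℤ):ℝ) ≤ (B:ℝ)+1 := by push_cast; linarith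
            exact_mod_cast this
      · intro i
        have h3 : (fun i => ⌊∑ j, α i j * ((a₂ - a₁) j : ℝ)⌋ + ((b₂ - b₁) i -
          ⌊∑ j, α i j * ((a₂ - a₁) j : ℝ)⌋)) = b₂ - b₁ := by funext i; ring
        have h2 : (sig α a₁ b₁ + t₀) i + sig α (a₂ - a₁) (b₂ - b₁) i = (sig α a₂ b₂ + t₀) i := by
          rw [sig_sub]; simp only [Pi.add_apply, Pi.sub_apply]; ring
        simp only
        rw [h3, h2]
        exact hbox i)
  refine hcov.trans ?_
  have hτp : 0 ≤ ∏ i, sig α (ga i) (gb i) i := Finset.prod_nonneg fun i _ => (hpos i).le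
  gcongr
  rw [hSdef, Finset.card_product, Fintype.card_piFinset, Fintype.card_piFinset]
  push_cast
  simp only [Int.card_Icc, Finset.prod_const, Finset.card_univ, Fintype.card_fin]
  have e1 : (((((B:ℤ)+1 + 1 - (-((B:ℤ)+1)))).toNat : ℕ) : ℝ) = 2 * B + 3 := by
    have : (((B:ℤ)+1 + 1 - (-((B:ℤ)+1)))).toNat = 2 * B + 3 := by omega
    rw [this]; push_cast; ring
  rw [e1]
  have e2 : (∏ j, (((⌊r j⌋ + 1 - -⌊r j⌋).toNat : ℕ) : ℝ)) ≤ 3 ^ d * ∏ j, r j := by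
    rw [show (3:ℝ)^d = ∏ j : Fin d, 3 by simp, ← Finset.prod_mul_distrib]
    apply Finset.prod_le_prod
    · intro j _; positivity
    · intro j _
      have h0 : 0 ≤ ⌊r j⌋ := Int.floor_nonneg.2 (by linarith [hr1 j])
      have : (((⌊r j⌋ + 1 - -⌊r j⌋).toNat : ℕ) : ℤ) = 2 * ⌊r j⌋ + 1 := by omega
      have h3 : (((⌊r j⌋ + 1 - -⌊r j⌋).toNat : ℕ) : ℝ) = 2 * ⌊r j⌋ + 1 := by exact_mod_cast this
      rw [h3]
      have := Int.floor_le (r j)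
      linarith [hr1 j]
  calc _ ≤ (3 ^ d * ∏ j, r j) * (2 * (B:ℝ) + 3) ^ n := by gcongr
    _ = _ := by ring

lemma vol_lemma2 (hD : DenseProp α) (hS : SearchProp α t₀ R)
    (hR1 : ∀ N, (∀ j, 1 ≤ N j) → ∀ j, 1 ≤ R N j) {K : ℝ}
    (hRK : ∀ N, (∀ j, 1 ≤ N j) → ∏ j, R N j ≤ K * ∏ j, (N j : ℝ)) :
    ∃ K₁ : ℝ, 0 < K₁ ∧ ∀ (ga : Fin n → Fin d → ℤ) (gb : Fin n → Fin n → ℤ),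
      (∀ i, 0 < sig α (ga i) (gb i) i) → (∀ i l, |sig α (ga i) (gb i) l| ≤ 1/16) →
      ∀ N : Fin d → ℕ, (∀ j, 1 ≤ N j) → (∀ i j, |ga i j| ≤ (N j : ℤ)) →
      1 ≤ K₁ * (∏ j, (N j : ℝ)) * ∏ i, sig α (ga i) (gb i) i := by
  obtain ⟨K₀, K₁, hK₁, h⟩ := vol_lemma hD hS hR1
  have hK : 0 < K := by
    have h1 := hRK (fun _ => 1) (fun _ => le_rfl)
    have h2 : (0:ℝ) < ∏ j, R (fun _ => 1) j :=
      Finset.prod_pos fun j _ => one_pos.trans_le (hR1 _ (fun _ => le_rfl) j)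
    simp at h1
    linarith
  refine ⟨K₁ * (K * (1 + K₀) ^ d), by positivity, fun ga gb hpos hsm N hN hgN => ?_⟩
  have h1 := h ga gb hpos hsm N hN hgN
  refine h1.trans ?_
  have hτp : 0 ≤ ∏ i, sig α (ga i) (gb i) i := Finset.prod_nonneg fun i _ => (hpos i).le
  have h2 := hRK (fun j => N j + K₀) (fun j => by have := hN j; omega)
  have h3 : ∏ j, ((N j + K₀ : ℕ) : ℝ) ≤ (1 + K₀) ^ d * ∏ j, (N j : ℝ) := by
    rw [show (1 + (K₀:ℝ))^d = ∏ j : Fin d, (1 + (K₀:ℝ)) by simp, ← Finset.prod_mul_distrib]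
    apply Finset.prod_le_prod
    · intro j _; positivity
    · intro j _
      have : (1:ℝ) ≤ N j := by exact_mod_cast hN j
      push_cast
      nlinarith [(Nat.cast_nonneg K₀ : (0:ℝ) ≤ K₀)]
  calc K₁ * (∏ j, R (fun j => N j + K₀) j) * ∏ i, sig α (ga i) (gb i) i
      ≤ K₁ * (K * ((1 + K₀) ^ d * ∏ j, (N j : ℝ))) * ∏ i, sig α (ga i) (gb i) i := by
        gcongr
        exact h2.trans (by gcongr)
    _ = _ := by ring

lemma small_vec (hD : DenseProp α) : ∃ a b, (∀ l, 0 < sig α a b l) ∧ ∀ l, |sig α a b l| ≤ 1/16 := by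
  obtain ⟨a, b, h⟩ := hD (fun _ => 1/32) (1/32) (by norm_num)
  refine ⟨a, b, fun l => ?_, fun l => ?_⟩ <;> have := abs_lt.1 (h l)
  · linarith
  · rw [abs_le]; constructor <;> linarith

lemma good_lemma (hD : DenseProp α) : ∃ K₄ : ℕ, 1 ≤ K₄ ∧ ∀ i a b, sig α a b i ≠ 0 →
    ∀ N : Fin d → ℕ, (∀ j, 1 ≤ N j) → (∀ j, |a j| ≤ (N j : ℤ)) →
    ∃ a' b', 0 < sig α a' b' i ∧ (∀ l, |sig α a' b' l| ≤ 1/16) ∧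
      (∀ j, |a' j| ≤ ((K₄ * N j : ℕ) : ℤ)) ∧ sig α a' b' i ≤ K₄ * |sig α a b i| := by
  obtain ⟨Q, hQ, hdir⟩ := simul_dirichlet n
  obtain ⟨a₀, b₀, hp0, hs0⟩ := small_vec hD
  have hQR : (1:ℝ) ≤ Q := by exact_mod_cast hQ
  refine ⟨Q + ∑ j, (a₀ j).natAbs, by omega, fun i a b hne N hN ha => ?_⟩
  by_cases hc : |sig α a b i| * (16 * Q) ≤ 1
  · obtain ⟨q, hq1, hqQ, b', hb'⟩ := hdir (fun l => ∑ j, α l j * (a j : ℝ))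
    have hqR : (q:ℝ) ≤ Q := by exact_mod_cast hqQ
    have hq0 : (1:ℝ) ≤ q := by exact_mod_cast hq1
    set b'' : Fin n → ℤ := fun l => if l = i then q * b l else b' l with hb''
    have hsum : ∀ l, ∑ j, α l j * (((q:ℤ) • a) j : ℝ) = q * ∑ j, α l j * (a j : ℝ) := by
      intro l
      rw [Finset.mul_sum]
      apply Finset.sum_congr rfl
      intro j _
      simp only [Pi.smul_apply, smul_eq_mul]; push_cast; ring
    have hi : sig α ((q:ℤ) • a) b'' i = q * sig α a b i := by
      simp only [sig]; rw [hsum]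
      simp only [hb'', if_true]; push_cast; ring
    have hl : ∀ l, |sig α ((q:ℤ) • a) b'' l| ≤ 1/16 := by
      intro l
      by_cases hli : l = i
      · subst hli
        rw [hi, abs_mul, abs_of_nonneg (by positivity)]
        have : (q:ℝ) * |sig α a b l| ≤ Q * |sig α a b l| := by gcongr
        nlinarith
      · simp only [sig]; rw [hsum]
        simp only [hb'', if_neg hli]
        exact hb' l
    have haj : ∀ j, |(((q:ℤ) • a) j)| ≤ (((Q + ∑ j, (a₀ j).natAbs) * N j : ℕ) : ℤ) := by
      intro j
      simp only [Pi.smul_apply, smul_eq_mul, abs_mul, Nat.abs_cast]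
      push_cast
      have h1 := ha j
      have h2 : (q:ℤ) ≤ Q + ∑ j, |a₀ j| := by
        have : 0 ≤ ∑ j, |a₀ j| := Finset.sum_nonneg fun _ _ => abs_nonneg _
        have : (q:ℤ) ≤ Q := by exact_mod_cast hqQ
        linarith
      gcongr
    have hle : (q:ℝ) * |sig α a b i| ≤ ((Q + ∑ j, (a₀ j).natAbs : ℕ) : ℝ) * |sig α a b i| := by
      gcongr
      omega
    rcases lt_or_gt_of_ne hne with hneg | hpos
    · refine ⟨-((q:ℤ) • a), -b'', ?_, ?_, ?_, ?_⟩
      · have := sig_smul (α := α) (-1) ((q:ℤ) • a) b''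
        rw [neg_one_smul, neg_one_smul] at this
        rw [this]; simp only [Pi.smul_apply, hi]; push_cast
        simp only [smul_eq_mul]; nlinarith
      · intro l
        have := sig_smul (α := α) (-1) ((q:ℤ) • a) b''
        rw [neg_one_smul, neg_one_smul] at this
        rw [this]; simp only [Pi.smul_apply]; push_cast
        simp only [smul_eq_mul, neg_one_mul, abs_neg]; exact hl l
      · intro j; rw [Pi.neg_apply, abs_neg]; exact haj j
      · have := sig_smul (α := α) (-1) ((q:ℤ) • a) b''
        rw [neg_one_smul, neg_one_smul] at this
        rw [this]; simp only [Pi.smul_apply, hi]; push_cast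
        rw [abs_of_neg hneg] at *
        push_cast at hle
        simp only [smul_eq_mul]; linarith
    · refine ⟨(q:ℤ) • a, b'', ?_, hl, haj, ?_⟩
      · rw [hi]; positivity
      · rw [hi]; rw [abs_of_pos hpos] at hle ⊢; exact hle
  · push Not at hc
    refine ⟨a₀, b₀, hp0 i, hs0, ?_, ?_⟩
    · intro j
      have h1 : (a₀ j).natAbs ≤ ∑ j, (a₀ j).natAbs :=
        Finset.single_le_sum (f := fun j => (a₀ j).natAbs) (fun _ _ => Nat.zero_le _)
          (Finset.mem_univ j)
      rw [Int.abs_eq_natAbs]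
      have h2 := hN j
      have : (a₀ j).natAbs ≤ (Q + ∑ j, (a₀ j).natAbs) * N j :=
        (by omega : _ ≤ Q + ∑ j, (a₀ j).natAbs).trans (Nat.le_mul_of_pos_right _ h2)
      exact_mod_cast this
    · have h1 := (le_abs_self _).trans (hs0 i)
      have h2 : (Q:ℝ) * |sig α a b i| ≤ ((Q + ∑ j, (a₀ j).natAbs : ℕ) : ℝ) * |sig α a b i| := by
        gcongr
        omega
      linarith

lemma vol_lemma3 (hD : DenseProp α) (hS : SearchProp α t₀ R)
    (hR1 : ∀ N, (∀ j, 1 ≤ N j) → ∀ j, 1 ≤ R N j) {K : ℝ}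
    (hRK : ∀ N, (∀ j, 1 ≤ N j) → ∏ j, R N j ≤ K * ∏ j, (N j : ℝ)) :
    ∃ K₁ : ℝ, 0 < K₁ ∧ ∀ (ma : Fin n → Fin d → ℤ) (mb : Fin n → Fin n → ℤ),
      (∀ i, sig α (ma i) (mb i) i ≠ 0) →
      ∀ N : Fin d → ℕ, (∀ j, 1 ≤ N j) → (∀ i j, |ma i j| ≤ (N j : ℤ)) →
      1 ≤ K₁ * (∏ j, (N j : ℝ)) * ∏ i, |sig α (ma i) (mb i) i| := by
  obtain ⟨K₁, hK₁, h⟩ := vol_lemma2 hD hS hR1 hRK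
  obtain ⟨K₄, hK₄, hg⟩ := good_lemma hD
  refine ⟨K₁ * K₄ ^ d * K₄ ^ n, by positivity, fun ma mb hne N hN hm => ?_⟩
  choose ga gb g1 g2 g3 g4 using fun i => hg i (ma i) (mb i) (hne i) N hN (hm i)
  refine (h ga gb g1 g2 (fun j => K₄ * N j) (fun j => Nat.mul_pos hK₄ (hN j)) g3).trans ?_
  have e1 : ∏ j, ((K₄ * N j : ℕ) : ℝ) = K₄ ^ d * ∏ j, (N j : ℝ) := by
    push_cast; rw [Finset.prod_mul_distrib]; simp
  have e2 : ∏ i, sig α (ga i) (gb i) i ≤ K₄ ^ n * ∏ i, |sig α (ma i) (mb i) i| := by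
    calc _ ≤ ∏ i, ((K₄:ℝ) * |sig α (ma i) (mb i) i|) :=
          Finset.prod_le_prod (fun i _ => (g1 i).le) (fun i _ => g4 i)
      _ = _ := by rw [Finset.prod_mul_distrib]; simp
  rw [e1]
  calc _ ≤ K₁ * (K₄ ^ d * ∏ j, (N j : ℝ)) * (K₄ ^ n * ∏ i, |sig α (ma i) (mb i) i|) := by
        gcongr
    _ = _ := by ring

end core2

section core3
variable {d n : ℕ} {α : Fin n → Fin d → ℝ} {t₀ : Fin n → ℝ} {R : (Fin d → ℕ) → Fin d → ℝ}

lemma sig_single (j : Fin d) (q p : ℤ) (i : Fin n) :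
    sig α (Pi.single j q) (fun _ => p) i = p - α i j * q := by
  simp only [sig]
  congr 1
  rw [Finset.sum_eq_single j]
  · simp
  · intro b _ hb; simp [hb]
  · simp

lemma abs_single_le (j j' : Fin d) (q : ℤ) {N : ℕ} (h : |q| ≤ N) :
    |(Pi.single j q : Fin d → ℤ) j'| ≤ (N : ℤ) := by
  by_cases hj : j' = j
  · subst hj; simpa using h
  · simp [hj]

lemma dep_lemma
    (littlewood : ∀ α β : ℝ,
      Filter.liminf
        (fun n : ℕ => (n : ℝ) * distInt ((n : ℝ) * α) * distInt ((n : ℝ) * β))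
        Filter.atTop = 0)
    (hD : DenseProp α) {K₁ : ℝ} (hK₁ : 0 < K₁)
    (hV : ∀ (ma : Fin n → Fin d → ℤ) (mb : Fin n → Fin n → ℤ),
      (∀ i, sig α (ma i) (mb i) i ≠ 0) →
      ∀ N : Fin d → ℕ, (∀ j, 1 ≤ N j) → (∀ i j, |ma i j| ≤ (N j : ℤ)) →
      1 ≤ K₁ * (∏ j, (N j : ℝ)) * ∏ i, |sig α (ma i) (mb i) i|)
    (i : Fin n) (j₁ j₂ : Fin d) (hj : j₁ ≠ j₂) :
    ∃ m₁ m₂ p : ℤ, ¬ (m₁ = 0 ∧ m₂ = 0) ∧ m₁ * α i j₁ + m₂ * α i j₂ = p := by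
  by_contra hcon
  push Not at hcon
  obtain ⟨a₀, b₀, hp0, hs0⟩ := small_vec hD
  set H : ℕ := 1 + ∑ j, (a₀ j).natAbs with hH
  have hH1 : 1 ≤ H := by omega
  have ha0 : ∀ j, |a₀ j| ≤ (H:ℤ) := by
    intro j
    have h1 : (a₀ j).natAbs ≤ ∑ j, (a₀ j).natAbs :=
      Finset.single_le_sum (f := fun j => (a₀ j).natAbs) (fun _ _ => Nat.zero_le _)
        (Finset.mem_univ j)
    rw [Int.abs_eq_natAbs]
    exact_mod_cast (by omega)
  set P : ℝ := ∏ x ∈ Finset.univ \ {i}, |sig α a₀ b₀ x| with hP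
  have hP0 : 0 < P := Finset.prod_pos fun x _ => abs_pos.2 (hp0 x).ne'
  obtain ⟨m₁, m₂, p, M, N, hne, hM, hN, hmM, hnN, hlt⟩ := littlewood_dual littlewood (α i j₁)
    (α i j₂) (ε := 1 / (K₁ * H ^ d * P)) (by positivity)
  set ma : Fin n → Fin d → ℤ :=
    Function.update (fun _ => a₀) i (Pi.single j₁ m₁ + Pi.single j₂ m₂) with hma
  set mb : Fin n → Fin n → ℤ := Function.update (fun _ => b₀) i (fun _ => p) with hmb
  have hsi : sig α (Pi.single j₁ m₁ + Pi.single j₂ m₂) (fun _ => p) i =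
      p - (m₁ * α i j₁ + m₂ * α i j₂) := by
    have := sig_add (α := α) (Pi.single j₁ m₁) (Pi.single j₂ m₂) (fun _ => p) (fun _ => 0)
    rw [show (fun _ : Fin n => p) + (fun _ => (0:ℤ)) = fun _ => p by funext; simp] at this
    rw [this, Pi.add_apply, sig_single, sig_single]; push_cast; ring
  have hfun : (fun x => |sig α (ma x) (mb x) x|) =
      Function.update (fun x => |sig α a₀ b₀ x|) i |m₁ * α i j₁ + m₂ * α i j₂ - p| := by
    funext x
    by_cases hx : x = i
    · subst hx
      simp only [hma, hmb, Function.update_self]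
      rw [hsi, abs_sub_comm]
    · simp only [hma, hmb, Function.update_of_ne hx]
  set NN : Fin d → ℕ := fun j => H * (if j = j₁ then M else 1) * (if j = j₂ then N else 1) with hNN
  have h1 := hV ma mb (by
      intro x
      rw [← abs_pos]
      have := congrFun hfun x
      rw [this]
      by_cases hx : x = i
      · subst hx
        rw [Function.update_self, abs_pos, sub_ne_zero]
        exact hcon m₁ m₂ p (fun h => by simpa [h] using hne)
      · rw [Function.update_of_ne hx]; exact abs_pos.2 (hp0 x).ne') NN (by
      intro j
      simp only [hNN]
      apply Nat.mul_pos (Nat.mul_pos hH1 _) _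
      · split_ifs <;> omega
      · split_ifs <;> omega) (by
      intro x j
      by_cases hx : x = i
      · subst hx
        simp only [hma, Function.update_self, Pi.add_apply]
        by_cases hj1 : j = j₁
        · subst hj1
          rw [Pi.single_eq_same, Pi.single_eq_of_ne hj, add_zero]
          simp only [hNN, if_true, if_neg hj, mul_one]
          push_cast
          have : (1:ℤ) ≤ H := by exact_mod_cast hH1
          nlinarith
        · by_cases hj2 : j = j₂
          · subst hj2
            rw [Pi.single_eq_same, Pi.single_eq_of_ne hj1, zero_add]
            simp only [hNN, if_true, if_neg hj1, mul_one]
            push_cast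
            have : (1:ℤ) ≤ H := by exact_mod_cast hH1
            nlinarith
          · rw [Pi.single_eq_of_ne hj1, Pi.single_eq_of_ne hj2]; simp
      · simp only [hma, Function.update_of_ne hx]
        refine (ha0 j).trans ?_
        have h2 : H ≤ NN j := by
          simp only [hNN]
          rw [mul_assoc]
          apply Nat.le_mul_of_pos_right
          apply Nat.mul_pos <;> split_ifs <;> omega
        exact_mod_cast h2)
  rw [hfun, Finset.prod_update_of_mem (Finset.mem_univ i)] at h1
  have hprod : ∏ j, (NN j : ℝ) = H ^ d * M * N := by
    simp only [hNN]
    push_cast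
    rw [Finset.prod_mul_distrib, Finset.prod_mul_distrib]
    simp
  rw [hprod, ← hP] at h1
  rw [lt_div_iff₀ (by positivity)] at hlt
  linarith

lemma irr_lemma (hD : DenseProp α) (i : Fin n) : ∃ j, Irrational (α i j) := by
  by_contra hcon
  push Not at hcon
  simp only [Irrational, not_not, Set.mem_range] at hcon
  choose r hr using hcon
  set D : ℕ := ∏ j, (r j).den with hDd
  have hD0 : 0 < D := Finset.prod_pos fun j _ => (r j).den_pos
  have hDR : (0:ℝ) < D := by exact_mod_cast hD0
  have hintg : ∀ j, ∃ c : ℤ, (D:ℝ) * α i j = c := by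
    intro j
    have hdvd : (r j).den ∣ D := Finset.dvd_prod_of_mem _ (Finset.mem_univ j)
    obtain ⟨e, he⟩ := hdvd
    refine ⟨e * (r j).num, ?_⟩
    have hqq : ((r j:ℝ)) * (r j).den = (r j).num := by exact_mod_cast Rat.mul_den_eq_num (r j)
    rw [← hr j, he]; push_cast; rw [← hqq]; ring
  choose c hc using hintg
  obtain ⟨a, b, h⟩ := hD (fun _ => 1 / (2 * D)) (1 / (2 * D)) (by positivity)
  have h1 := abs_lt.1 (h i)
  have e : (D:ℝ) * sig α a b i = ((D * b i - ∑ j, c j * a j : ℤ) : ℝ) := by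
    simp only [sig]; push_cast
    rw [mul_sub, Finset.mul_sum]
    congr 1
    exact Finset.sum_congr rfl fun j _ => by rw [← hc j]; ring
  have h2 : 0 < (D:ℝ) * sig α a b i := mul_pos hDR (by linarith)
  have h3 : (D:ℝ) * sig α a b i < 1 := by
    have : sig α a b i < 1 / D := by
      have : (1:ℝ) / D = 1 / (2*D) + 1 / (2*D) := by field_simp; norm_num
      linarith
    rw [lt_div_iff₀ hDR] at this
    linarith
  rw [e] at h2 h3
  have h2' : 0 < (D * b i - ∑ j, c j * a j : ℤ) := by exact_mod_cast h2
  have h3' : (D * b i - ∑ j, c j * a j : ℤ) < 1 := by exact_mod_cast h3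
  omega

lemma irr_ne {β : ℝ} (h : Irrational β) {q p : ℤ} (hq : q ≠ 0) : (p:ℝ) - β * q ≠ 0 := by
  have h1 := (h.mul_intCast hq)
  intro h0
  exact h1.ne_int p (by linarith)

lemma n_le_d (hD : DenseProp α) {K₁ : ℝ}
    (hV : ∀ (ma : Fin n → Fin d → ℤ) (mb : Fin n → Fin n → ℤ),
      (∀ i, sig α (ma i) (mb i) i ≠ 0) →
      ∀ N : Fin d → ℕ, (∀ j, 1 ≤ N j) → (∀ i j, |ma i j| ≤ (N j : ℤ)) →
      1 ≤ K₁ * (∏ j, (N j : ℝ)) * ∏ i, |sig α (ma i) (mb i) i|) (hK₁ : 0 < K₁) : n ≤ d := by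
  by_contra hlt
  push Not at hlt
  choose J hJ using irr_lemma hD
  obtain ⟨N, hN⟩ := exists_nat_gt K₁
  have hN0 : 0 < N := by
    have : (0:ℝ) < N := hK₁.trans hN
    exact_mod_cast this
  have hN0R : (0:ℝ) < N := by exact_mod_cast hN0
  choose p q hq0 hqN hpq using fun i => Real.exists_int_int_abs_mul_sub_le (α i (J i)) hN0
  have h1 := hV (fun i => Pi.single (J i) (q i)) (fun i _ => p i) (by
      intro i
      rw [sig_single]
      exact irr_ne (hJ i) (hq0 i).ne') (fun _ => N) (fun _ => hN0) (by
      intro i j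
      apply abs_single_le
      rw [abs_of_pos (hq0 i)]; exact hqN i)
  have h2 : ∏ i, |sig α (Pi.single (J i) (q i)) (fun _ => p i) i| ≤ (1 / (N:ℝ)) ^ n := by
    calc _ ≤ ∏ i : Fin n, (1 / (N:ℝ)) := by
          apply Finset.prod_le_prod
          · intro i _; positivity
          · intro i _
            rw [sig_single, abs_sub_comm, mul_comm]
            refine (hpq i).trans ?_
            gcongr; linarith
      _ = _ := by simp
  have h3 : (1:ℝ) ≤ K₁ * N ^ d * (1 / (N:ℝ)) ^ n := by
    refine h1.trans ?_
    simp only [Finset.prod_const, Finset.card_univ, Fintype.card_fin]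
    gcongr
  rw [one_div, inv_pow, ← div_eq_mul_inv, one_le_div (by positivity)] at h3
  have hN1 : (1:ℝ) ≤ N := by exact_mod_cast hN0
  have h4 : (N:ℝ) ^ (d+1) ≤ N ^ n := pow_le_pow_right₀ hN1 hlt
  have h5 : (0:ℝ) < N ^ d := by positivity
  rw [pow_succ] at h4
  nlinarith

lemma lin_lemma {i : Fin n}
    (hdep : ∀ j₁ j₂ : Fin d, j₁ ≠ j₂ →
      ∃ m₁ m₂ p : ℤ, ¬ (m₁ = 0 ∧ m₂ = 0) ∧ m₁ * α i j₁ + m₂ * α i j₂ = p)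
    {j₀ : Fin d} (hirr : Irrational (α i j₀)) :
    ∃ (M : ℤ) (u p : Fin d → ℤ), M ≠ 0 ∧ ∀ j, (M:ℝ) * α i j = u j * α i j₀ + p j := by
  have h : ∀ j, ∃ A B C : ℤ, A ≠ 0 ∧ (A:ℝ) * α i j = B * α i j₀ + C := by
    intro j
    by_cases hj : j = j₀
    · subst hj; exact ⟨1, 1, 0, one_ne_zero, by simp⟩
    · obtain ⟨m₁, m₂, p, hne, h⟩ := hdep j j₀ hj
      refine ⟨m₁, -m₂, p, ?_, by push_cast; linarith⟩
      intro h0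
      subst h0
      have hm2 : m₂ ≠ 0 := fun h => hne ⟨rfl, h⟩
      apply irr_ne hirr (p := p) hm2
      push_cast at h
      linarith
  choose A B C hA hABC using h
  refine ⟨∏ j, A j, fun j => (∏ l ∈ Finset.univ.erase j, A l) * B j,
    fun j => (∏ l ∈ Finset.univ.erase j, A l) * C j, Finset.prod_ne_zero_iff.2 fun j _ => hA j, ?_⟩
  intro j
  rw [← Finset.mul_prod_erase _ _ (Finset.mem_univ j)]
  push_cast
  linear_combination (∏ l ∈ Finset.univ.erase j, (A l : ℝ)) * hABC j

lemma d_le_n (hAP : ∀ a b, sig α a b = 0 → a = 0) (J : Fin n → Fin d)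
    (hlin : ∀ i, ∃ (M : ℤ) (u p : Fin d → ℤ), M ≠ 0 ∧
      ∀ j, (M:ℝ) * α i j = u j * α i (J i) + p j) : d ≤ n := by
  choose M u p hM h using hlin
  by_contra hlt
  push Not at hlt
  have hni : ¬ Function.Injective (Matrix.mulVecLin (Matrix.of u)) := by
    intro hinj
    have := LinearMap.finrank_le_finrank_of_injective hinj
    simp at this
    omega
  rw [← LinearMap.ker_eq_bot, Submodule.eq_bot_iff] at hni
  push Not at hni
  obtain ⟨a, ha, hane⟩ := hni
  have ha' : ∀ i, ∑ j, u i j * a j = 0 := by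
    intro i
    have := congrFun (LinearMap.mem_ker.1 ha) i
    simpa [Matrix.mulVec, dotProduct] using this
  apply hane
  have hP : (∏ i, M i) ≠ 0 := Finset.prod_ne_zero_iff.2 fun j _ => hM j
  have h0 := hAP ((∏ i, M i) • a)
    (fun i => (∏ l ∈ Finset.univ.erase i, M l) * ∑ j, p i j * a j) (by
      funext i
      have e : (M i : ℝ) * ∑ j, α i j * (a j : ℝ) = ∑ j, (p i j : ℝ) * a j := by
        have hz : ∑ j, (u i j : ℝ) * a j = 0 := by exact_mod_cast ha' i
        calc (M i : ℝ) * ∑ j, α i j * (a j : ℝ) = ∑ j, (M i * α i j) * (a j : ℝ) := by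
              rw [Finset.mul_sum]; exact Finset.sum_congr rfl fun j _ => by ring
          _ = ∑ j, (α i (J i) * (u i j * (a j : ℝ)) + p i j * a j) :=
              Finset.sum_congr rfl fun j _ => by rw [h i j]; ring
          _ = α i (J i) * ∑ j, (u i j : ℝ) * a j + ∑ j, (p i j : ℝ) * a j := by
              rw [Finset.sum_add_distrib, Finset.mul_sum]
          _ = _ := by rw [hz]; ring
      simp only [sig, Pi.zero_apply, Pi.smul_apply, smul_eq_mul]
      rw [← Finset.mul_prod_erase _ _ (Finset.mem_univ i)]
      push_cast
      rw [← e, sub_eq_zero, Finset.mul_sum, Finset.mul_sum]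
      exact Finset.sum_congr rfl fun j _ => by ring)
  exact (smul_eq_zero.1 h0).resolve_left hP

end core3

section core4
variable {d n : ℕ} {α : Fin n → Fin d → ℝ} {t₀ : Fin n → ℝ} {R : (Fin d → ℕ) → Fin d → ℝ}

lemma ball_lemma (hD : DenseProp α) (hS : SearchProp α t₀ R)
    (hR1 : ∀ N, (∀ j, 1 ≤ N j) → ∀ j, 1 ≤ R N j) {K : ℝ} (hK : 0 < K)
    (hRK : ∀ N, (∀ j, 1 ≤ N j) → ∀ j, R N j ≤ K * Real.sqrt (∏ j, (N j : ℝ)))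
    (i : Fin n) {j₀ : Fin d} (hirr : Irrational (α i j₀))
    {M : ℤ} {u p : Fin d → ℤ} (hM : M ≠ 0)
    (hlin : ∀ j, (M:ℝ) * α i j = u j * α i j₀ + p j) : False := by
  obtain ⟨K₀, hbox⟩ := box_lemma hD hS
  obtain ⟨K₄, hK₄, hgood⟩ := good_lemma hD
  obtain ⟨a₀, b₀, hp0, hs0⟩ := small_vec hD
  obtain ⟨B, hB⟩ := win_bound α
  set β := α i j₀ with hβ
  set H : ℕ := 1 + ∑ j, (a₀ j).natAbs with hH
  have hH1 : 1 ≤ H := by omega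
  have ha0 : ∀ j, |a₀ j| ≤ (H:ℤ) := by
    intro j
    have h1 : (a₀ j).natAbs ≤ ∑ j, (a₀ j).natAbs :=
      Finset.single_le_sum (f := fun j => (a₀ j).natAbs) (fun _ _ => Nat.zero_le _)
        (Finset.mem_univ j)
    rw [Int.abs_eq_natAbs]
    exact_mod_cast (by omega)
  set G : ℕ := H * K₄ + K₀ with hG
  set U : ℝ := ∑ j, |(u j : ℝ)| with hU
  have hU0 : 0 ≤ U := Finset.sum_nonneg fun _ _ => abs_nonneg _
  set MB : ℕ := M.natAbs * B with hMB
  set C₁ : ℝ := (2 * (U * (K * Real.sqrt (G ^ d))) + 1) * (2 * MB + 3) * K₄ with hC₁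
  have hC₁0 : 0 ≤ C₁ := by positivity
  have main : ∀ T : ℕ, 1 ≤ T → Real.sqrt T ≤ C₁ := by
    intro T hT
    have hTR : (1:ℝ) ≤ T := by exact_mod_cast hT
    obtain ⟨p', q, hq0, hqT, hpq⟩ := Real.exists_int_int_abs_mul_sub_le β hT
    set Nb : Fin d → ℕ := fun j => if j = j₀ then T else 1 with hNb
    have hNb1 : ∀ j, 1 ≤ Nb j := by intro j; simp only [hNb]; split_ifs <;> omega
    obtain ⟨a', b', g1, g2, g3, g4⟩ := hgood i (Pi.single j₀ q) (fun _ => p')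
      (by rw [sig_single]; exact irr_ne hirr hq0.ne') Nb hNb1 (by
        intro j
        by_cases hj : j = j₀
        · subst hj; simp only [Pi.single_eq_same, hNb, if_true]; rw [abs_of_pos hq0]; exact hqT
        · rw [Pi.single_eq_of_ne hj]; simp)
    rw [sig_single, abs_sub_comm, mul_comm (α i j₀)] at g4
    have hτ : sig α a' b' i ≤ K₄ / T := by
      refine g4.trans ?_
      rw [div_eq_mul_one_div]
      gcongr
      refine hpq.trans ?_
      gcongr; linarith
    set N : Fin d → ℕ := fun j => H * K₄ * Nb j with hN
    obtain ⟨lo, hlo⟩ := hbox (fun l => if l = i then a' else a₀) (fun l => if l = i then b' else b₀)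
      (by intro l; by_cases hl : l = i
          · subst hl; simpa using g1
          · simpa [hl] using hp0 l)
      (by intro l l'; by_cases hl : l = i
          · subst hl; simpa using g2 l'
          · simpa [hl] using hs0 l') N (fun j => Nat.mul_pos (Nat.mul_pos hH1 hK₄) (hNb1 j)) (by
        intro l j
        by_cases hl : l = i
        · simp only [hl, if_true]
          refine (g3 j).trans ?_
          have : K₄ * Nb j ≤ N j := by
            simp only [hN]; rw [mul_assoc]; exact Nat.le_mul_of_pos_left _ hH1
          exact_mod_cast this
        · simp only [hl, if_false]
          refine (ha0 j).trans ?_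
          have : H ≤ N j := by
            simp only [hN]; rw [mul_assoc]
            exact Nat.le_mul_of_pos_right _ (Nat.mul_pos hK₄ (hNb1 j))
          exact_mod_cast this)
    set r : ℝ := K * Real.sqrt (G ^ d) * Real.sqrt T with hr
    have hr0 : 0 ≤ r := by positivity
    have hRr : ∀ j, R (fun j => N j + K₀) j ≤ r := by
      intro j
      refine (hRK _ (fun j => ?_) j).trans ?_
      · have := Nat.mul_pos (Nat.mul_pos hH1 hK₄) (hNb1 j)
        simp only [hN]; omega
      · rw [hr, mul_assoc, ← Real.sqrt_mul (by positivity)]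
        gcongr
        calc ∏ j, ((N j + K₀ : ℕ) : ℝ) ≤ ∏ j, ((G:ℝ) * (if j = j₀ then (T:ℝ) else 1)) := by
              apply Finset.prod_le_prod
              · intro j _; positivity
              · intro j _
                have h1 := hNb1 j
                have : N j + K₀ ≤ G * Nb j := by
                  simp only [hN, hG]; nlinarith
                have h2 : ((N j + K₀ : ℕ) : ℝ) ≤ G * Nb j := by exact_mod_cast this
                refine h2.trans (le_of_eq ?_)
                simp only [hNb]; split_ifs <;> simp
          _ = _ := by rw [Finset.prod_mul_distrib]; simp
    set S : Finset (ℤ × ℤ) := Finset.Icc (-⌊U * r⌋) ⌊U * r⌋ ×ˢ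
      Finset.Icc (-((MB:ℤ) + 1)) ((MB:ℤ) + 1) with hSdef
    have hcov := cover_lemma (ι := Unit) S (fun z _ => ((⌊z.1 * β⌋ : ℝ) + z.2 - z.1 * β) / M)
      (fun _ => lo i) (fun _ => sig α a' b' i) (fun _ => g1.le) (by
        intro x hx ε hε
        set y := x () with hy
        have hy01 : y ∈ Ioo (0:ℝ) 1 := hx ()
        obtain ⟨a₁, b₁, h₁⟩ := hD (fun l => y - t₀ l) (min ε (min y (1 - y)))
          (lt_min hε (lt_min hy01.1 (by linarith [hy01.2])))
        have h1W : sig α a₁ b₁ + t₀ ∈ Win α := by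
          apply cube_mem
          intro l
          have h1 := abs_lt.1 ((h₁ l).trans_le ((min_le_right _ _).trans (min_le_left _ _)))
          have h2 := abs_lt.1 ((h₁ l).trans_le ((min_le_right _ _).trans (min_le_right _ _)))
          simp only [Pi.add_apply]
          constructor <;> linarith
        obtain ⟨a₂, b₂, hW, hRR, hb⟩ := hlo a₁ b₁ h1W
        have hdiff : (sig α a₂ b₂ + t₀) i - (sig α a₁ b₁ + t₀) i =
            sig α (a₂ - a₁) (b₂ - b₁) i := by rw [sig_sub]; simp
        set a := a₂ - a₁ with ha
        set b := b₂ - b₁ with hb'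
        set V : ℤ := ∑ j, u j * a j with hV
        set Z : ℤ := M * b i - ∑ j, p j * a j with hZ
        have hMR : (M:ℝ) ≠ 0 := by exact_mod_cast hM
        have hsig : (M:ℝ) * sig α a b i = Z - V * β := by
          simp only [sig, hZ, hV]
          push_cast
          rw [mul_sub, Finset.mul_sum, Finset.sum_mul, sub_sub, ← Finset.sum_add_distrib]
          congr 1
          exact Finset.sum_congr rfl fun j _ => by linear_combination (a j : ℝ) * hlin j
        have hVr : |(V:ℝ)| ≤ U * r := by
          rw [hV]; push_cast
          rw [hU, Finset.sum_mul]
          refine (Finset.abs_sum_le_sum_abs _ _).trans (Finset.sum_le_sum fun j _ => ?_)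
          rw [abs_mul]
          have := (hRR j).trans (hRr j)
          have e : (a j : ℝ) = a₂ j - a₁ j := by rw [ha]; simp
          rw [e]
          gcongr
        refine ⟨fun _ => (sig α a₁ b₁ + t₀) i, ?_, (V, Z - ⌊V * β⌋), ?_, ?_⟩
        · intro _
          have := (h₁ i).trans_le (min_le_left _ _)
          have e : (sig α a₁ b₁ + t₀) i - y = sig α a₁ b₁ i - (y - t₀ i) := by
            simp only [Pi.add_apply]; ring
          change |(sig α a₁ b₁ + t₀) i - y| < ε
          rw [e]; exact this
        · simp only [hSdef, Finset.mem_product, Finset.mem_Icc]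
          constructor
          · rw [← abs_le, Int.le_floor]; push_cast; exact hVr
          · have h1 := hB _ hW _ h1W i
            rw [hdiff] at h1
            have h2 : |(Z:ℝ) - V * β| ≤ MB := by
              rw [← hsig, abs_mul, hMB]
              push_cast
              rw [Nat.cast_natAbs]; push_cast
              gcongr
            have h2 := abs_le.1 h2
            have f1 := Int.floor_le ((V:ℝ) * β)
            have f2 := Int.lt_floor_add_one ((V:ℝ) * β)
            constructor
            · have : (-((MB:ℝ)+1)) ≤ ((Z - ⌊(V:ℝ) * β⌋ : ℤ):ℝ) := by push_cast; linarith
              exact_mod_cast this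
            · have : ((Z - ⌊(V:ℝ) * β⌋ : ℤ):ℝ) ≤ (MB:ℝ)+1 := by push_cast; linarith
              exact_mod_cast this
        · intro _
          have e : ((⌊(V:ℝ) * β⌋ : ℝ) + ((Z - ⌊(V:ℝ) * β⌋ : ℤ) : ℝ) - V * β) / M = sig α a b i := by
            rw [div_eq_iff hMR]; push_cast; linarith
          simp only
          rw [e, ← hdiff, add_sub_cancel]
          simpa using hb i)
    have hcard : (S.card : ℝ) ≤ (2 * (U * r) + 1) * (2 * MB + 3) := by
      rw [hSdef, Finset.card_product, Int.card_Icc, Int.card_Icc]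
      push_cast
      have e1 : (((MB:ℤ) + 1 + 1 - -((MB:ℤ) + 1)).toNat : ℝ) = 2 * MB + 3 := by
        have : ((MB:ℤ) + 1 + 1 - -((MB:ℤ) + 1)).toNat = 2 * MB + 3 := by omega
        rw [this]; push_cast; ring
      have h0 : 0 ≤ ⌊U * r⌋ := Int.floor_nonneg.2 (by positivity)
      have e2 : ((⌊U * r⌋ + 1 - -⌊U * r⌋).toNat : ℝ) = 2 * ⌊U * r⌋ + 1 := by
        have : ((⌊U * r⌋ + 1 - -⌊U * r⌋).toNat : ℤ) = 2 * ⌊U * r⌋ + 1 := by omega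
        exact_mod_cast this
      rw [e1, e2]
      have := Int.floor_le (U * r)
      gcongr
    simp only [Finset.univ_unique, Finset.prod_singleton] at hcov
    have hs1 : 1 ≤ Real.sqrt T := by rw [Real.one_le_sqrt]; exact hTR
    have hfin : (1:ℝ) ≤ C₁ * Real.sqrt T / T := by
      calc (1:ℝ) ≤ _ := hcov
        _ ≤ ((2 * (U * r) + 1) * (2 * MB + 3)) * (K₄ / T) := by gcongr
        _ ≤ (((2 * (U * (K * Real.sqrt (G ^ d))) + 1) * Real.sqrt T) * (2 * MB + 3)) * (K₄ / T) := by
            gcongr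
            rw [hr]; nlinarith
        _ = _ := by rw [hC₁]; ring
    rw [le_div_iff₀ (by positivity), one_mul] at hfin
    have hss := Real.mul_self_sqrt (show (0:ℝ) ≤ T by positivity)
    nlinarith
  obtain ⟨X, hX⟩ := exists_nat_gt C₁
  have hX0 : 0 < X := by
    have : (0:ℝ) < X := hC₁0.trans_lt hX
    exact_mod_cast this
  have := main (X ^ 2) (Nat.one_le_pow _ _ hX0)
  push_cast at this
  rw [Real.sqrt_sq (by positivity)] at this
  linarith

/-- Combined core statement: the numbers of physical and internal dimensions agree. -/
lemma core_main
    (littlewood : ∀ α β : ℝ,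
      Filter.liminf
        (fun n : ℕ => (n : ℝ) * distInt ((n : ℝ) * α) * distInt ((n : ℝ) * β))
        Filter.atTop = 0)
    (hD : DenseProp α) (hS : SearchProp α t₀ R)
    (hAP : ∀ a b, sig α a b = 0 → a = 0)
    (hR1 : ∀ N, (∀ j, 1 ≤ N j) → ∀ j, 1 ≤ R N j) {K : ℝ}
    (hRK : ∀ N, (∀ j, 1 ≤ N j) → ∏ j, R N j ≤ K * ∏ j, (N j : ℝ)) :
    n = d ∧ ∀ i, ∃ (j₀ : Fin d) (M : ℤ) (u p : Fin d → ℤ), Irrational (α i j₀) ∧ M ≠ 0 ∧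
      ∀ j, (M:ℝ) * α i j = u j * α i j₀ + p j := by
  obtain ⟨K₁, hK₁, hV⟩ := vol_lemma3 hD hS hR1 hRK
  choose J hJ using irr_lemma hD
  have hdep := dep_lemma littlewood hD hK₁ hV
  have hlin := fun i => lin_lemma (hdep i) (hJ i)
  refine ⟨le_antisymm (n_le_d hD hV hK₁) (d_le_n hAP J hlin), fun i => ?_⟩
  obtain ⟨M, u, p, hM, h⟩ := hlin i
  exact ⟨J i, M, u, p, hJ i, hM, h⟩

end core4

section reduction
variable {d n : ℕ} (𝒟 : CPS (d + n) d)

namespace CPS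

lemma E_ext {e : Fin (d + n) → ℝ} (he : e ∈ 𝒟.E)
    (h0 : ∀ j : Fin d, e (Fin.castAdd n j) = 0) : e = 0 := by
  let L : 𝒟.E →ₗ[ℝ] (Fin d → ℝ) :=
    { toFun := fun v j => (v : Fin (d + n) → ℝ) (Fin.castAdd n j)
      map_add' := fun _ _ => rfl
      map_smul' := fun _ _ => rfl }
  have hs : Function.Surjective L := by
    intro z
    refine ⟨⟨𝒟.rho (emb (d + n) d z), 𝒟.rho_mem _⟩, ?_⟩
    funext j
    have := 𝒟.rho_decomp (emb (d + n) d z) (Fin.castAdd n j) (by simp)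
    have h2 : emb (d + n) d z (Fin.castAdd n j) = z j := by simp [emb]
    show 𝒟.rho (emb (d + n) d z) (Fin.castAdd n j) = z j
    linarith
  have hf : Module.finrank ℝ 𝒟.E = Module.finrank ℝ (Fin d → ℝ) := by
    rw [𝒟.rank_E]; simp
  have hi : Function.Injective L :=
    (LinearMap.injective_iff_surjective_of_finrank_eq_finrank hf).2 hs
  have : (⟨e, he⟩ : 𝒟.E) = 0 := by
    apply hi
    funext j
    simpa [L] using h0 j
  simpa using congrArg Subtype.val this

/-- Coefficients describing `E` as a graph over the first `d` coordinates. -/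
def alpha (i : Fin n) (j : Fin d) : ℝ :=
  𝒟.rho (emb (d + n) d (Pi.single j 1)) (Fin.natAdd d i)

lemma rho_castAdd (x : Fin (d + n) → ℝ) (j : Fin d) :
    𝒟.rho x (Fin.castAdd n j) = x (Fin.castAdd n j) := by
  have := 𝒟.rho_decomp x (Fin.castAdd n j) (by simp)
  linarith

lemma emb_castAdd (z : Fin d → ℝ) (j : Fin d) : emb (d + n) d z (Fin.castAdd n j) = z j := by
  simp [emb]

lemma rho_ext {x y : Fin (d + n) → ℝ}
    (h : ∀ j : Fin d, x (Fin.castAdd n j) = y (Fin.castAdd n j)) : 𝒟.rho x = 𝒟.rho y := by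
  have := 𝒟.E_ext (𝒟.E.sub_mem (𝒟.rho_mem x) (𝒟.rho_mem y)) (by
    intro j
    simp [rho_castAdd, h])
  exact sub_eq_zero.1 this

lemma rho_id {e : Fin (d + n) → ℝ} (he : e ∈ 𝒟.E) : 𝒟.rho e = e := by
  have := 𝒟.E_ext (𝒟.E.sub_mem (𝒟.rho_mem e) he) (by
    intro j
    simp [rho_castAdd])
  exact sub_eq_zero.1 this

lemma rho_natAdd (x : Fin (d + n) → ℝ) (i : Fin n) :
    𝒟.rho x (Fin.natAdd d i) = ∑ j, 𝒟.alpha i j * x (Fin.castAdd n j) := by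
  have h : 𝒟.rho x =
      𝒟.rho (∑ j, x (Fin.castAdd n j) • emb (d + n) d (Pi.single j 1)) := by
    apply rho_ext
    intro j
    simp [emb_castAdd, Finset.sum_apply, Pi.single_apply]
  rw [h, map_sum, Finset.sum_apply]
  refine Finset.sum_congr rfl fun j _ => ?_
  rw [map_smul, Pi.smul_apply, smul_eq_mul, mul_comm]
  rfl

lemma rhoStar_natAdd (x : Fin (d + n) → ℝ) (i : Fin n) :
    𝒟.rhoStar x (Fin.natAdd d i) =
      x (Fin.natAdd d i) - ∑ j, 𝒟.alpha i j * x (Fin.castAdd n j) := by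
  simp [rhoStar, rho_natAdd]

lemma rhoStar_castAdd (x : Fin (d + n) → ℝ) (j : Fin d) :
    𝒟.rhoStar x (Fin.castAdd n j) = 0 := by
  simp [rhoStar, rho_castAdd]

lemma fin_ext {x y : Fin (d + n) → ℝ} (h1 : ∀ j : Fin d, x (Fin.castAdd n j) = y (Fin.castAdd n j))
    (h2 : ∀ i : Fin n, x (Fin.natAdd d i) = y (Fin.natAdd d i)) : x = y := by
  funext i
  exact Fin.addCases h1 h2 i

lemma mem_strip_iff (hc : 𝒟.IsCanonical) (z : Fin (d + n) → ℝ) :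
    z ∈ 𝒟.strip ↔ (fun i => 𝒟.rhoStar z (Fin.natAdd d i)) ∈ Win 𝒟.alpha := by
  unfold IsCanonical at hc
  constructor
  · rintro ⟨w, hw, e, he, rfl⟩
    rw [hc] at hw
    obtain ⟨x, hx, rfl⟩ := hw
    refine ⟨fun j => x (Fin.castAdd n j), fun i => x (Fin.natAdd d i), fun j => hx _,
      fun i => hx _, fun i => ?_⟩
    have : 𝒟.rhoStar (𝒟.rhoStar x + e) = 𝒟.rhoStar x := by
      have h1 : 𝒟.rho (x - 𝒟.rho x + e) = e := by
        rw [map_add, map_sub, 𝒟.rho_id (𝒟.rho_mem x), 𝒟.rho_id he]; simp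
      simp only [rhoStar]
      rw [h1]; simp
    rw [this]
    exact 𝒟.rhoStar_natAdd x i
  · rintro ⟨x, y, hx, hy, h⟩
    refine ⟨𝒟.rhoStar z, ?_, 𝒟.rho z, 𝒟.rho_mem z, by simp [rhoStar]⟩
    rw [hc]
    refine ⟨Fin.append x y, ?_, ?_⟩
    · intro i
      refine Fin.addCases (fun j => ?_) (fun j => ?_) i
      · simpa using hx j
      · simpa using hy j
    · apply fin_ext
      · intro j; rw [rhoStar_castAdd, rhoStar_castAdd]
      · intro i
        refine Eq.trans ?_ (h i).symm
        rw [rhoStar_natAdd]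
        simp

/-- The internal coordinates of `s`. -/
def tzero (i : Fin n) : ℝ := 𝒟.rhoStar 𝒟.s (Fin.natAdd d i)

lemma rhoStar_add (x y : Fin (d + n) → ℝ) :
    𝒟.rhoStar (x + y) = 𝒟.rhoStar x + 𝒟.rhoStar y := by
  simp only [rhoStar, map_add]; abel

lemma rhoStar_int (a : Fin d → ℤ) (b : Fin n → ℤ) (i : Fin n) :
    𝒟.rhoStar (intVec (Fin.append a b)) (Fin.natAdd d i) = sig 𝒟.alpha a b i := by
  rw [rhoStar_natAdd]
  simp [intVec, sig]

lemma int_mem_strip_iff (hc : 𝒟.IsCanonical) (a : Fin d → ℤ) (b : Fin n → ℤ) :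
    intVec (Fin.append a b) + 𝒟.s ∈ 𝒟.strip ↔ sig 𝒟.alpha a b + 𝒟.tzero ∈ Win 𝒟.alpha := by
  rw [mem_strip_iff _ hc]
  have : (fun i => 𝒟.rhoStar (intVec (Fin.append a b) + 𝒟.s) (Fin.natAdd d i)) =
      sig 𝒟.alpha a b + 𝒟.tzero := by
    funext i
    rw [rhoStar_add, Pi.add_apply, rhoStar_int]; rfl
  rw [this]

lemma append_split (m : Fin (d + n) → ℤ) :
    Fin.append (fun j => m (Fin.castAdd n j)) (fun i => m (Fin.natAdd d i)) = m := by
  funext i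
  refine Fin.addCases (fun j => ?_) (fun j => ?_) i <;> simp

lemma append_add (a a' : Fin d → ℤ) (b b' : Fin n → ℤ) :
    Fin.append (a + a') (b + b') = Fin.append a b + Fin.append a' b' := by
  funext i
  refine Fin.addCases (fun j => ?_) (fun j => ?_) i <;> simp

lemma denseProp : DenseProp 𝒟.alpha := by
  intro t ε hε
  let f : (Fin (d + n) → ℝ) → (Fin n → ℝ) := fun x i => 𝒟.rhoStar x (Fin.natAdd d i)
  have hf : Continuous f := by
    have : Continuous 𝒟.rho := LinearMap.continuous_of_finiteDimensional _
    show Continuous fun x i => (x - 𝒟.rho x) (Fin.natAdd d i)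
    fun_prop
  have hop : IsOpen (f ⁻¹' Metric.ball t ε) := Metric.isOpen_ball.preimage hf
  have hne : (f ⁻¹' Metric.ball t ε).Nonempty := by
    refine ⟨Fin.append 0 t, ?_⟩
    have : f (Fin.append 0 t) = t := by
      funext i
      simp [f, rhoStar_natAdd]
    rw [mem_preimage, this]
    exact Metric.mem_ball_self hε
  obtain ⟨x, hx, e, he, m, rfl⟩ := 𝒟.totallyIrrational.inter_open_nonempty _ hop hne
  refine ⟨fun j => m (Fin.castAdd n j), fun i => m (Fin.natAdd d i), fun i => ?_⟩
  rw [← rhoStar_int, append_split]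
  have h1 : 𝒟.rhoStar (e + intVec m) = 𝒟.rhoStar (intVec m) := by
    rw [rhoStar_add]
    have : 𝒟.rhoStar e = 0 := by simp [rhoStar, 𝒟.rho_id he]
    rw [this, zero_add]
  have h2 : dist (f (e + intVec m)) t < ε := hx
  have h3 := (dist_le_pi_dist (f (e + intVec m)) t i).trans_lt h2
  rw [Real.dist_eq] at h3
  simp only [f] at h3
  rwa [h1] at h3

lemma intVec_add (m m' : Fin (d + n) → ℤ) : intVec (m + m') = intVec m + intVec m' := by
  funext i; simp [intVec]

lemma strip_add_E {z e : Fin (d + n) → ℝ} (hz : z ∈ 𝒟.strip) (he : e ∈ 𝒟.E) :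
    z + e ∈ 𝒟.strip := by
  obtain ⟨w, hw, e', he', rfl⟩ := hz
  exact ⟨w, hw, e' + e, 𝒟.E.add_mem he' he, by abel⟩

lemma ap_prop (hap : 𝒟.Aperiodic) (a : Fin d → ℤ) (b : Fin n → ℤ)
    (h : sig 𝒟.alpha a b = 0) : a = 0 := by
  have h1 : 𝒟.rhoStar (intVec (Fin.append a b)) = 0 := by
    apply fin_ext
    · intro j; rw [rhoStar_castAdd]; rfl
    · intro i; rw [rhoStar_int, h]; rfl
  have hE : intVec (Fin.append a b) ∈ 𝒟.E := by
    have : intVec (Fin.append a b) = 𝒟.rho (intVec (Fin.append a b)) := sub_eq_zero.1 h1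
    rw [this]; exact 𝒟.rho_mem _
  have hv := hap _ hE (by
    ext z
    constructor
    · rintro ⟨_, ⟨_, ⟨hs, m, rfl⟩, rfl⟩, rfl⟩
      refine ⟨intVec m + 𝒟.s + intVec (Fin.append a b), ⟨𝒟.strip_add_E hs hE,
        m + Fin.append a b, ?_⟩, ?_⟩
      · rw [intVec_add]; abel
      · rw [map_add _ _ (intVec (Fin.append a b)), 𝒟.proj_id _ hE]
    · rintro ⟨_, ⟨hs, m, rfl⟩, rfl⟩
      refine ⟨𝒟.proj (intVec m + 𝒟.s + -intVec (Fin.append a b)),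
        ⟨_, ⟨𝒟.strip_add_E hs (𝒟.E.neg_mem hE), m + -Fin.append a b, ?_⟩, rfl⟩, ?_⟩
      · rw [intVec_add]
        have : intVec (-Fin.append a b) = -intVec (Fin.append a b) := by
          funext i; simp [intVec]
        rw [this]; abel
      · rw [map_add _ _ (-intVec (Fin.append a b)), map_neg, 𝒟.proj_id _ hE]; abel)
  funext j
  have := congrFun hv (Fin.castAdd n j)
  simpa [intVec] using this

lemma proj_inj_s {m m' : Fin (d + n) → ℤ}
    (h : 𝒟.proj (intVec m + 𝒟.s) = 𝒟.proj (intVec m' + 𝒟.s)) : m = m' := by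
  apply 𝒟.proj_inj
  simpa using h

lemma intRep_eq {m : Fin (d + n) → ℤ} (h : intVec m + 𝒟.s ∈ 𝒟.strip) :
    𝒟.intRep (𝒟.proj (intVec m + 𝒟.s)) = m := by
  have := Classical.epsilon_spec (p := fun m' : Fin (d + n) → ℤ =>
    intVec m' + 𝒟.s ∈ 𝒟.strip ∧ 𝒟.proj (intVec m' + 𝒟.s) = 𝒟.proj (intVec m + 𝒟.s)) ⟨m, h, rfl⟩
  exact 𝒟.proj_inj_s this.2

/-- The symmetric integer box. -/
def box (N : Fin d → ℕ) : Set (Fin d → ℝ) :=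
  {x : Fin d → ℝ | ∀ i, ((-(N i : ℤ) : ℤ) : ℝ) ≤ x i ∧ x i ≤ (((N i : ℤ)) : ℝ)}

lemma box_mem (N : Fin d → ℕ) (hN : ∀ j, 1 ≤ N j) : box N ∈ RdCollection d :=
  ⟨fun j => -(N j : ℤ), fun j => (N j : ℤ), fun j => by have := hN j; show -(N j : ℤ) < (N j : ℤ); omega, rfl⟩

lemma patch_transfer (N : Fin d → ℕ) {m₀ m₂ m : Fin (d + n) → ℤ}
    (h₀ : intVec m₀ + 𝒟.s ∈ 𝒟.strip) (h₂ : intVec m₂ + 𝒟.s ∈ 𝒟.strip)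
    (hP : 𝒟.PatchEquiv (box N) (𝒟.proj (intVec m₂ + 𝒟.s)) (𝒟.proj (intVec m₀ + 𝒟.s)))
    (hm : ∀ j : Fin d, |m (Fin.castAdd n j)| ≤ (N j : ℤ))
    (h : intVec (m₀ + m) + 𝒟.s ∈ 𝒟.strip) : intVec (m₂ + m) + 𝒟.s ∈ 𝒟.strip := by
  have hp : 𝒟.proj (intVec (m₀ + m) + 𝒟.s) ∈ 𝒟.patch (box N) (𝒟.proj (intVec m₀ + 𝒟.s)) := by
    refine ⟨⟨_, ⟨h, _, rfl⟩, rfl⟩, ?_⟩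
    rw [𝒟.intRep_eq h, 𝒟.intRep_eq h₀]
    refine ⟨_, ⟨fun j => (m (Fin.castAdd n j) : ℝ), ?_, rfl⟩, ?_⟩
    · intro j
      have := abs_le.1 (hm j)
      constructor
      · show ((-(N j : ℤ) : ℤ) : ℝ) ≤ (m (Fin.castAdd n j) : ℝ)
        exact_mod_cast this.1
      · show (m (Fin.castAdd n j) : ℝ) ≤ ((N j : ℤ) : ℝ)
        exact_mod_cast this.2
    · apply rho_ext
      intro j
      rw [emb_castAdd]
      simp [intVec]
  have hq : 𝒟.proj (intVec (m₀ + m) + 𝒟.s) +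
      (𝒟.proj (intVec m₂ + 𝒟.s) - 𝒟.proj (intVec m₀ + 𝒟.s)) ∈
      𝒟.patch (box N) (𝒟.proj (intVec m₂ + 𝒟.s)) := by
    unfold PatchEquiv at hP
    rw [hP]
    exact ⟨_, hp, rfl⟩
  obtain ⟨⟨_, ⟨hs, m', rfl⟩, he⟩, -⟩ := hq
  have : m' = m₂ + m := by
    apply 𝒟.proj_inj_s
    rw [he]
    simp only [intVec_add, map_add]
    abel
  rwa [← this]

lemma window_proj_bound (hc : 𝒟.IsCanonical) :
    ∃ B : ℝ, 0 ≤ B ∧ ∀ w ∈ 𝒟.window, ‖𝒟.proj w‖ ≤ B := by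
  have hK : IsCompact (Icc (0 : Fin (d + n) → ℝ) 1) := isCompact_Icc
  have hcont : Continuous fun x => 𝒟.proj (𝒟.rhoStar x) := by
    have h1 : Continuous 𝒟.rho := LinearMap.continuous_of_finiteDimensional _
    have h2 : Continuous 𝒟.proj := LinearMap.continuous_of_finiteDimensional _
    show Continuous fun x => 𝒟.proj (x - 𝒟.rho x)
    fun_prop
  obtain ⟨B, hB⟩ := hK.exists_bound_of_continuousOn hcont.continuousOn
  refine ⟨|B|, abs_nonneg _, fun w hw => ?_⟩
  unfold IsCanonical at hc
  rw [hc] at hw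
  obtain ⟨x, hx, rfl⟩ := hw
  exact (hB x ⟨fun i => (hx i).1, fun i => (hx i).2⟩).trans (le_abs_self _)

lemma strip_proj_bound {B : ℝ} (hB : ∀ w ∈ 𝒟.window, ‖𝒟.proj w‖ ≤ B)
    {u : Fin (d + n) → ℝ} (hu : u ∈ 𝒟.strip) (j : Fin d) :
    |u (Fin.castAdd n j) - 𝒟.proj u (Fin.castAdd n j)| ≤ B := by
  obtain ⟨w, hw, e, he, rfl⟩ := hu
  have h1 : w (Fin.castAdd n j) = 0 := 𝒟.window_sub w hw _ (by simp)
  have h2 : |𝒟.proj w (Fin.castAdd n j)| ≤ B :=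
    (norm_le_pi_norm (𝒟.proj w) (Fin.castAdd n j)).trans (hB w hw)
  rw [map_add, 𝒟.proj_id e he, Pi.add_apply, Pi.add_apply, h1]
  have : (0 + e (Fin.castAdd n j) - (𝒟.proj w (Fin.castAdd n j) + e (Fin.castAdd n j))) =
    -(𝒟.proj w (Fin.castAdd n j)) := by ring
  rwa [this, abs_neg]

lemma searchProp (hc : 𝒟.IsCanonical) {B : ℝ} (hB : ∀ w ∈ 𝒟.window, ‖𝒟.proj w‖ ≤ B)
    (Reg : (Fin d → ℕ) → (Fin d → ℝ) → Set (Fin d → ℝ)) (R : (Fin d → ℕ) → Fin d → ℝ)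
    (hReg : ∀ N, (∀ j, 1 ≤ N j) → ∀ x, ∀ z ∈ Reg N x, ∀ j, |z j - x j| + 2 * B ≤ R N j)
    (hocc : ∀ N, (∀ j, 1 ≤ N j) → ∀ y ∈ 𝒟.Y, ∀ x,
      𝒟.OccursIn (box N) y (𝒟.rho '' (emb (d + n) d '' Reg N x))) :
    SearchProp 𝒟.alpha 𝒟.tzero R := by
  intro N hN a₀ b₀ h₀ a₁ b₁ h₁
  rw [← int_mem_strip_iff _ hc] at h₀ h₁
  obtain ⟨y₂, ⟨⟨u₂, ⟨hu₂, m₂, rfl⟩, rfl⟩, ⟨_, ⟨z, hz, rfl⟩, hzy⟩⟩, hP⟩ := hocc N hN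
    (𝒟.proj (intVec (Fin.append a₀ b₀) + 𝒟.s)) ⟨_, ⟨h₀, _, rfl⟩, rfl⟩
    (fun j => 𝒟.proj (intVec (Fin.append a₁ b₁) + 𝒟.s) (Fin.castAdd n j))
  refine ⟨fun j => m₂ (Fin.castAdd n j), fun i => m₂ (Fin.natAdd d i), ?_, ?_, ?_⟩
  · rw [← int_mem_strip_iff _ hc, append_split]; exact hu₂
  · intro j
    have e1 := 𝒟.strip_proj_bound hB hu₂ j
    have e2 := 𝒟.strip_proj_bound hB h₁ j
    have e3 := hReg N hN _ z hz j
    have e4 : z j = 𝒟.proj (intVec m₂ + 𝒟.s) (Fin.castAdd n j) := by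
      rw [← hzy, rho_castAdd, emb_castAdd]
    rw [e4] at e3
    have g1 : (intVec m₂ + 𝒟.s) (Fin.castAdd n j) =
        (m₂ (Fin.castAdd n j) : ℝ) + 𝒟.s (Fin.castAdd n j) := rfl
    have g2 : (intVec (Fin.append a₁ b₁) + 𝒟.s) (Fin.castAdd n j) =
        (a₁ j : ℝ) + 𝒟.s (Fin.castAdd n j) := by simp [intVec]
    rw [g1] at e1
    rw [g2] at e2
    refine le_trans ?_ e3
    rw [abs_le] at e1 e2
    have f1 := le_abs_self (𝒟.proj (intVec m₂ + 𝒟.s) (Fin.castAdd n j) -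
      𝒟.proj (intVec (Fin.append a₁ b₁) + 𝒟.s) (Fin.castAdd n j))
    have f2 := neg_abs_le (𝒟.proj (intVec m₂ + 𝒟.s) (Fin.castAdd n j) -
      𝒟.proj (intVec (Fin.append a₁ b₁) + 𝒟.s) (Fin.castAdd n j))
    rw [abs_le]
    constructor <;> linarith
  · intro a b hab h
    rw [← int_mem_strip_iff _ hc, append_add] at h ⊢
    rw [append_split]
    exact 𝒟.patch_transfer N h₀ hu₂ hP (by intro j; simpa using hab j) h

lemma omega_case (littlewood : ∀ α β : ℝ,
      Filter.liminf
        (fun n : ℕ => (n : ℝ) * distInt ((n : ℝ) * α) * distInt ((n : ℝ) * β))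
        Filter.atTop = 0) (hcan : 𝒟.IsCanonicalCPSet) (h : 𝒟.IsLROmega (RdCollection d)) :
    n = d := by
  obtain ⟨C, hC, hocc⟩ := h
  obtain ⟨B, hB0, hB⟩ := 𝒟.window_proj_bound hcan.1
  have hS : SearchProp 𝒟.alpha 𝒟.tzero (fun N j => (C + 2 * B + 1) * (N j : ℝ)) := by
    refine 𝒟.searchProp hcan.1 hB (fun N x => {z | ∃ w ∈ box N, z = x + C • w}) _ ?_ ?_
    · rintro N hN x _ ⟨w, hw, rfl⟩ j
      have h1 : |w j| ≤ (N j : ℝ) := by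
        have := hw j
        push_cast at this
        exact abs_le.2 this
      have h2 : (1 : ℝ) ≤ N j := by exact_mod_cast hN j
      have h3 : |(x + C • w) j - x j| = C * |w j| := by
        simp [abs_mul, abs_of_pos hC]
      rw [h3]
      nlinarith
    · intro N hN y hy x
      exact hocc _ (box_mem N hN) y hy x
  refine (core_main littlewood 𝒟.denseProp hS (𝒟.ap_prop hcan.2.2) ?_
    (K := (C + 2 * B + 1) ^ d) ?_).1
  · intro N hN j
    have h2 : (1 : ℝ) ≤ N j := by exact_mod_cast hN j
    nlinarith
  · intro N hN
    rw [Finset.prod_mul_distrib]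
    simp

lemma box_volume (N : Fin d → ℕ) : volume (box N) = ENNReal.ofReal (2 ^ d * ∏ j, (N j : ℝ)) := by
  have : box N = Icc (fun j => -(N j : ℝ)) (fun j => (N j : ℝ)) := by
    ext x
    simp only [box, Set.mem_ofPred_eq, mem_Icc, Pi.le_def]
    push_cast
    exact forall_and
  rw [this, Real.volume_Icc_pi, ← ENNReal.ofReal_prod_of_nonneg]
  · congr 1
    have : ∀ j, (N j : ℝ) - -(N j : ℝ) = 2 * N j := fun j => by ring
    simp only [this, Finset.prod_mul_distrib]
    simp
  · intro j _
    have : (0 : ℝ) ≤ N j := by positivity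
    linarith

lemma ball_case (littlewood : ∀ α β : ℝ,
      Filter.liminf
        (fun n : ℕ => (n : ℝ) * distInt ((n : ℝ) * α) * distInt ((n : ℝ) * β))
        Filter.atTop = 0) (hd : 1 ≤ d) (hcan : 𝒟.IsCanonicalCPSet)
    (h : 𝒟.IsLR (RdCollection d)) : n = 1 ∧ d = 1 := by
  obtain ⟨C, hC, hocc⟩ := h
  obtain ⟨B, hB0, hB⟩ := 𝒟.window_proj_bound hcan.1
  have hd0 : d ≠ 0 := by omega
  set c : ℝ := C ^ ((1 : ℝ) / d) with hc
  have hcp : 0 < c := Real.rpow_pos_of_pos hC _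
  have hcd : c ^ d = C := by
    rw [hc, one_div]; exact Real.rpow_inv_natCast_pow hC.le hd0
  let g : (Fin d → ℕ) → ℝ := fun N => (∏ j, (N j : ℝ)) ^ ((1 : ℝ) / d)
  have hP1 : ∀ N : Fin d → ℕ, (∀ j, 1 ≤ N j) → (1 : ℝ) ≤ ∏ j, (N j : ℝ) := by
    intro N hN
    have : 1 ≤ ∏ j, N j := Finset.one_le_prod' (fun j _ => hN j)
    exact_mod_cast this
  have hg1 : ∀ N : Fin d → ℕ, (∀ j, 1 ≤ N j) → 1 ≤ g N := by
    intro N hN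
    exact Real.one_le_rpow (hP1 N hN) (by positivity)
  have hgd : ∀ N : Fin d → ℕ, g N ^ d = ∏ j, (N j : ℝ) := by
    intro N
    simp only [g]
    rw [one_div]; exact Real.rpow_inv_natCast_pow (by positivity) hd0
  have hS : SearchProp 𝒟.alpha 𝒟.tzero (fun N _ => (c + 2 * B + 1) * g N) := by
    refine 𝒟.searchProp hcan.1 hB (fun N x => Metric.closedBall x (c * g N)) _ ?_ ?_
    · intro N hN x z hz j
      have h1 : |z j - x j| ≤ c * g N := by
        rw [← Real.dist_eq]
        exact (dist_le_pi_dist z x j).trans hz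
      have h2 := hg1 N hN
      nlinarith
    · intro N hN y hy x
      refine hocc _ (box_mem N hN) y hy x _ ?_
      have h2 := hg1 N hN
      rw [box_volume, Real.volume_pi_closedBall _ (by positivity),
        ← ENNReal.ofReal_mul hC.le, Fintype.card_fin]
      congr 1
      rw [mul_pow, mul_pow, hcd, hgd]; ring
  have hR1 : ∀ N : Fin d → ℕ, (∀ j, 1 ≤ N j) → ∀ j : Fin d,
      1 ≤ (fun (N : Fin d → ℕ) (_ : Fin d) => (c + 2 * B + 1) * g N) N j := by
    intro N hN j
    have h2 := hg1 N hN
    show 1 ≤ (c + 2 * B + 1) * g N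
    nlinarith
  obtain ⟨hnd, hlin⟩ := core_main littlewood 𝒟.denseProp hS (𝒟.ap_prop hcan.2.2) hR1
    (K := (c + 2 * B + 1) ^ d) (by
      intro N hN
      simp [mul_pow, hgd])
  by_contra hne
  have hd2 : 2 ≤ d := by omega
  obtain ⟨j₀, M, u, p, hirr, hM, hl⟩ := hlin ⟨0, by omega⟩
  refine ball_lemma 𝒟.denseProp hS hR1 (K := c + 2 * B + 1) (by positivity) ?_ _ hirr hM hl
  intro N hN j
  apply mul_le_mul_of_nonneg_left _ (by positivity)
  rw [Real.sqrt_eq_rpow]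
  apply Real.rpow_le_rpow_of_exponent_le (hP1 N hN)
  have : (2 : ℝ) ≤ d := by exact_mod_cast hd2
  exact one_div_le_one_div_of_le (by norm_num) this

end CPS

end reduction

/-- Assuming the Littlewood conjecture: (i) for all integers `k > d ≥ 1`
with `(k,d) ≠ (2,1)` there is no `k` to `d` canonical cut and project set which is LR
with respect to `ℛ_d`; and (ii) for every `d ≥ 1` and every integer `k > d` with
`k ≠ 2d` there is no `k` to `d` canonical cut and project set which is `LR_Ω` with
respect to `ℛ_d`. -/
theorem littlewood_implies_no_canonical_LR_LROmega_wrt_Rd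
    (littlewood : ∀ α β : ℝ,
      Filter.liminf
        (fun n : ℕ => (n : ℝ) * distInt ((n : ℝ) * α) * distInt ((n : ℝ) * β))
        Filter.atTop = 0) :
    (∀ k d : ℕ, 1 ≤ d → d < k → ¬(k = 2 ∧ d = 1) →
      ∀ 𝒟 : CPS k d, 𝒟.IsCanonicalCPSet → ¬ 𝒟.IsLR (RdCollection d)) ∧
    (∀ k d : ℕ, 1 ≤ d → d < k → k ≠ 2 * d →
      ∀ 𝒟 : CPS k d, 𝒟.IsCanonicalCPSet → ¬ 𝒟.IsLROmega (RdCollection d)) := by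
  constructor
  · intro k d hd hdk hne 𝒟 hcan hLR
    obtain ⟨n, rfl⟩ := Nat.exists_eq_add_of_le hdk.le
    obtain ⟨h1, h2⟩ := 𝒟.ball_case littlewood hd hcan hLR
    exact hne ⟨by omega, h2⟩
  · intro k d hd hdk hne 𝒟 hcan hLR
    obtain ⟨n, rfl⟩ := Nat.exists_eq_add_of_le hdk.le
    have := 𝒟.omega_case littlewood hcan hLR
    omega
end
end

section
/- Let m ≥ 1 and α₁,…,α_m ∈ ℝ. Then liminf_{n→∞} n‖nα₁‖⋯‖nα_m‖ > 0 (n ranging over positive integers) if and only if there exists a constant c > 0 such that for every nonzero integer vector n = (n₁,…,n_m) ∈ ℤ^m, ‖n₁α₁ + ⋯ + n_mα_m‖ > c/((1+|n₁|)⋯(1+|n_m|)). -/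
noncomputable section

open MeasureTheory Set Filter

lemma dI_le (x : ℝ) (z : ℤ) : distInt x ≤ |x - z| := round_le x z

lemma dI_nonneg (x : ℝ) : 0 ≤ distInt x := abs_nonneg _

lemma dI_le_one (x : ℝ) : distInt x ≤ 1 := (abs_sub_round x).trans (by norm_num)

lemma dI_mul (k : ℕ) (x : ℝ) : distInt (k * x) ≤ k * distInt x := by
  have h := dI_le (k * x) (k * round x)
  refine h.trans (le_of_eq ?_)
  unfold distInt
  push_cast
  rw [← mul_sub, abs_mul, Nat.abs_cast]

lemma dirichlet_box {m : ℕ} (α : Fin m → ℝ) (k : Fin m → ℕ) (hk : ∀ i, 0 < k i) :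
    ∃ q : ℕ, 1 ≤ q ∧ q ≤ ∏ i, k i ∧ ∀ i, distInt (q * α i) ≤ 1 / (k i : ℝ) := by
  classical
  let g : ℕ → Fin m → ℤ := fun q i => ⌊(k i : ℝ) * Int.fract ((q : ℝ) * α i)⌋
  have hcard : (Fintype.piFinset (fun i => Finset.Ico (0 : ℤ) (k i))).card <
      (Finset.range (∏ i, k i + 1)).card := by
    simp [Fintype.card_piFinset]
  have hmaps : ∀ q ∈ Finset.range (∏ i, k i + 1),
      g q ∈ Fintype.piFinset (fun i => Finset.Ico (0 : ℤ) (k i)) := by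
    intro q _
    rw [Fintype.mem_piFinset]
    intro i
    have hki : (0 : ℝ) < k i := by exact_mod_cast hk i
    rw [Finset.mem_Ico]
    constructor
    · exact Int.floor_nonneg.2 (mul_nonneg hki.le (Int.fract_nonneg _))
    · rw [Int.floor_lt]
      have := Int.fract_lt_one ((q : ℝ) * α i)
      push_cast
      nlinarith
  obtain ⟨a, ha, b, hb, hab, he⟩ := Finset.exists_ne_map_eq_of_card_lt_of_maps_to hcard hmaps
  have key : ∃ a b : ℕ, a < b ∧ b ≤ ∏ i, k i ∧ g a = g b := by
    rw [Finset.mem_range] at ha hb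
    rcases lt_or_gt_of_ne hab with h | h
    · exact ⟨a, b, h, by omega, he⟩
    · exact ⟨b, a, h, by omega, he.symm⟩
  obtain ⟨a, b, hab, hb, he⟩ := key
  refine ⟨b - a, by omega, by omega, fun i => ?_⟩
  have hki : (0 : ℝ) < k i := by exact_mod_cast hk i
  have h1 := Int.abs_sub_lt_one_of_floor_eq_floor (congrFun he i)
  rw [← mul_sub, abs_mul, Nat.abs_cast] at h1
  rw [le_div_iff₀ hki]
  have h2 := dI_le ((b - a : ℕ) * α i) (⌊(b : ℝ) * α i⌋ - ⌊(a : ℝ) * α i⌋)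
  have h3 : |((b - a : ℕ) : ℝ) * α i - ((⌊(b : ℝ) * α i⌋ - ⌊(a : ℝ) * α i⌋ : ℤ) : ℝ)|
      = |Int.fract ((a : ℝ) * α i) - Int.fract ((b : ℝ) * α i)| := by
    rw [abs_sub_comm (Int.fract _)]
    congr 1
    rw [Nat.cast_sub hab.le]
    unfold Int.fract
    push_cast
    ring
  rw [h3] at h2
  nlinarith

lemma to_dual {m : ℕ} (hm : 1 ≤ m) (α : Fin m → ℝ) (c : ℝ) (hc : 0 < c)
    (h : ∀ q : ℕ, 1 ≤ q → c ≤ q * ∏ i, distInt (q * α i)) :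
    ∃ c > (0 : ℝ), ∀ n : Fin m → ℤ, n ≠ 0 →
      c / ∏ i, (1 + |(n i : ℝ)|) < distInt (∑ i, (n i : ℝ) * α i) := by
  classical
  have hm' : (1 : ℝ) ≤ m := by exact_mod_cast hm
  obtain ⟨K, hK⟩ := exists_nat_gt (max (4 * (m : ℝ)) (4 * m / c))
  have hK1 : 4 * (m : ℝ) < K := (le_max_left _ _).trans_lt hK
  have hK2 : 4 * (m : ℝ) / c < K := (le_max_right _ _).trans_lt hK
  have hK0 : (0 : ℝ) < K := by linarith
  refine ⟨1 / (2 * (K : ℝ) ^ m), by positivity, fun n hn => ?_⟩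
  by_contra hcon
  push Not at hcon
  obtain ⟨j, hj⟩ := Function.ne_iff.1 hn
  simp only [Pi.zero_apply] at hj
  set S := ∑ i, (n i : ℝ) * α i with hS
  set N := ∏ i, (1 + |(n i : ℝ)|) with hN
  have hNpos : 0 < N := Finset.prod_pos fun i _ => by positivity
  let a : Fin m → ℕ := fun i => if i = j then 2 else K
  have hKn : 0 < K := by exact_mod_cast hK0
  have ha : ∀ i, 0 < a i := by intro i; simp only [a]; split_ifs <;> omega
  obtain ⟨q, hq1, hq2, hq3⟩ := dirichlet_box α (fun i => a i * (1 + (n i).natAbs))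
    (fun i => Nat.mul_pos (ha i) (by omega))
  set P : ℝ := ∏ i, (a i : ℝ) with hP
  have hPpos : 0 < P := Finset.prod_pos fun i _ => by exact_mod_cast ha i
  have hKP : K * P = 2 * (K : ℝ) ^ m := by
    have e1 : ∏ i, ((if i = j then (K : ℝ) else 1) * (a i : ℝ)) =
        ∏ i : Fin m, ((if i = j then (2 : ℝ) else 1) * K) := by
      refine Finset.prod_congr rfl fun i _ => ?_
      simp only [a]
      split_ifs
      · push_cast; ring
      · rfl
    rw [Finset.prod_mul_distrib, Finset.prod_mul_distrib, Finset.prod_ite_eq',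
      Finset.prod_ite_eq'] at e1
    simpa using e1
  have hcast : ∀ i, (((a i * (1 + (n i).natAbs) : ℕ)) : ℝ) = a i * (1 + |(n i : ℝ)|) := by
    intro i
    push_cast
    rw [Nat.cast_natAbs, Int.cast_abs]
  have hqPN : (q : ℝ) ≤ P * N := by
    have : (q : ℝ) ≤ ((∏ i, (a i * (1 + (n i).natAbs)) : ℕ) : ℝ) := by exact_mod_cast hq2
    rw [Nat.cast_prod] at this
    simp only [hcast] at this
    rwa [Finset.prod_mul_distrib] at this
  have hd : ∀ i, distInt (q * α i) * (1 + |(n i : ℝ)|) ≤ 1 / a i := by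
    intro i
    have h1 := hq3 i
    rw [hcast] at h1
    have h2 : (0 : ℝ) < a i := by exact_mod_cast ha i
    have h3 : 0 < 1 + |(n i : ℝ)| := by positivity
    rw [le_div_iff₀ (by positivity)] at h1 ⊢
    linarith
  have hqe : q * distInt S ≤ 1 / K := by
    calc q * distInt S ≤ (P * N) * (1 / (2 * (K : ℝ) ^ m) / N) :=
          mul_le_mul hqPN hcon (dI_nonneg _) (by positivity)
      _ = 1 / K := by rw [← hKP]; field_simp
  set x : Fin m → ℝ := fun i => q * α i - round (q * α i) with hx
  have hxd : ∀ i, |x i| = distInt (q * α i) := fun i => rfl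
  set R : ℝ := q * (round S - S) + ∑ i ∈ Finset.univ.erase j, n i * x i with hR
  have hnx : ∀ i, |n i * x i| ≤ 1 / a i := by
    intro i
    rw [abs_mul, hxd]
    have := hd i
    have := dI_nonneg (q * α i)
    linarith
  have hRb : |R| ≤ m / K := by
    have h1 : |(q : ℝ) * (round S - S)| ≤ 1 / K := by
      rw [abs_mul, Nat.abs_cast, abs_sub_comm]; exact hqe
    have h2 : |∑ i ∈ Finset.univ.erase j, n i * x i| ≤ (m - 1) * (1 / K) := by
      refine (Finset.abs_sum_le_sum_abs _ _).trans ?_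
      have : ∑ i ∈ Finset.univ.erase j, |n i * x i| ≤
          ∑ i ∈ Finset.univ.erase j, (1 / K : ℝ) := by
        refine Finset.sum_le_sum fun i hi => ?_
        have h := hnx i
        simpa [a, Finset.ne_of_mem_erase hi] using h
      refine this.trans (le_of_eq ?_)
      rw [Finset.sum_const, Finset.card_erase_of_mem (Finset.mem_univ _), Finset.card_univ,
        Fintype.card_fin, nsmul_eq_mul, Nat.cast_sub hm, Nat.cast_one]
    calc |R| ≤ _ := abs_add_le _ _
      _ ≤ 1 / K + (m - 1) * (1 / K) := add_le_add h1 h2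
      _ = m / K := by ring
  have hR4 : (m : ℝ) / K < 1 / 4 := by rw [div_lt_iff₀ hK0]; linarith
  have hI : ((q * round S - ∑ i, n i * round (q * α i) : ℤ) : ℝ) = R + n j * x j := by
    have e : R + n j * x j = q * (round S - S) + ∑ i, n i * x i := by
      rw [hR, add_assoc, Finset.sum_erase_add _ _ (Finset.mem_univ j)]
    rw [e]
    have e2 : ∑ i, n i * x i = q * S - ∑ i, (n i : ℝ) * round (q * α i) := by
      rw [hS, Finset.mul_sum, ← Finset.sum_sub_distrib]
      refine Finset.sum_congr rfl fun i _ => ?_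
      simp only [hx]; ring
    rw [e2]
    push_cast
    ring
  have hnj := hnx j
  have haj : (a j : ℝ) = 2 := by simp [a]
  rw [haj] at hnj
  have hI0 : (q * round S - ∑ i, n i * round (q * α i) : ℤ) = 0 := by
    apply Int.abs_lt_one_iff.1
    have : |((q * round S - ∑ i, n i * round (q * α i) : ℤ) : ℝ)| < 1 := by
      rw [hI]
      have := abs_add_le R (n j * x j)
      linarith
    exact_mod_cast this
  rw [hI0, Int.cast_zero] at hI
  have hxj : |x j| * (1 + |(n j : ℝ)|) ≤ 2 * m / K := by
    have h1 : |n j * x j| ≤ m / K := by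
      have : (n j * x j : ℝ) = -R := by linarith
      rw [this, abs_neg]; exact hRb
    rw [abs_mul] at h1
    have h2 : (1 : ℝ) ≤ |(n j : ℝ)| := by exact_mod_cast Int.one_le_abs hj
    have h3 := abs_nonneg (x j)
    have : 2 * (m : ℝ) / K = 2 * (m / K) := by ring
    nlinarith
  let b : Fin m → ℝ := fun i => if i = j then 2 * m / K else 1 / K
  have hb : ∀ i, distInt (q * α i) * (1 + |(n i : ℝ)|) ≤ b i := by
    intro i
    by_cases hij : i = j
    · subst hij; rw [hxd] at hxj; simpa [b] using hxj
    · have := hd i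
      simpa [b, a, hij] using this
  have hPb : P * ∏ i, b i = 4 * m / K := by
    rw [hP, ← Finset.prod_mul_distrib]
    have : ∀ i, (a i : ℝ) * b i = if i = j then 4 * (m : ℝ) / K else 1 := by
      intro i
      simp only [a, b]
      split_ifs
      · push_cast; ring
      · field_simp
    simp only [this]
    rw [Finset.prod_ite_eq']
    simp
  have hprod : (∏ i, distInt (q * α i)) * N ≤ ∏ i, b i := by
    rw [hN, ← Finset.prod_mul_distrib]
    exact Finset.prod_le_prod (fun i _ => mul_nonneg (dI_nonneg _) (by positivity))
      (fun i _ => hb i)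
  have hD : 0 ≤ ∏ i, distInt (q * α i) := Finset.prod_nonneg fun i _ => dI_nonneg _
  have hfin : q * ∏ i, distInt (q * α i) ≤ 4 * m / K := by
    calc q * ∏ i, distInt (q * α i) ≤ (P * N) * ∏ i, distInt (q * α i) :=
          mul_le_mul_of_nonneg_right hqPN hD
      _ = P * ((∏ i, distInt (q * α i)) * N) := by ring
      _ ≤ P * ∏ i, b i := mul_le_mul_of_nonneg_left hprod hPpos.le
      _ = _ := hPb
  have := h q hq1
  rw [div_lt_iff₀ hc] at hK2
  have : c ≤ 4 * m / K := this.trans hfin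
  rw [le_div_iff₀ hK0] at this
  linarith

lemma shrink_box {m : ℕ} (q : ℕ) (hq : 1 ≤ q) : ∀ (s : ℕ) (N : Fin m → ℕ), ∑ i, N i = s →
    q < ∏ i, (1 + N i) →
    ∃ N' : Fin m → ℕ, (∀ i, N' i ≤ N i) ∧ q < ∏ i, (1 + N' i) ∧ ∏ i, (1 + N' i) ≤ 2 * q := by
  classical
  intro s
  induction s using Nat.strong_induction_on with
  | _ s ih =>
    intro N hs hN
    by_cases h2 : ∏ i, (1 + N i) ≤ 2 * q
    · exact ⟨N, fun i => le_rfl, hN, h2⟩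
    · have : ∃ j, N j ≠ 0 := by
        by_contra hall
        push Not at hall
        simp [hall] at hN
        omega
      obtain ⟨j, hj⟩ := this
      let M : Fin m → ℕ := Function.update N j (N j - 1)
      have hMle : ∀ i, M i ≤ N i := by
        intro i
        by_cases hij : i = j
        · subst hij; simp [M]
        · simp [M, hij]
      have hMj : M j = N j - 1 := by simp [M]
      have hlt : ∑ i, M i < s := by
        rw [← hs]
        exact Finset.sum_lt_sum (fun i _ => hMle i) ⟨j, Finset.mem_univ j, by omega⟩
      have e1 := Finset.mul_prod_erase Finset.univ (fun i => 1 + N i) (Finset.mem_univ j)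
      have e2 := Finset.mul_prod_erase Finset.univ (fun i => 1 + M i) (Finset.mem_univ j)
      have e3 : ∏ i ∈ Finset.univ.erase j, (1 + M i) = ∏ i ∈ Finset.univ.erase j, (1 + N i) := by
        refine Finset.prod_congr rfl fun i hi => ?_
        simp [M, Finset.ne_of_mem_erase hi]
      rw [e3, hMj] at e2
      have hMq : q < ∏ i, (1 + M i) := by
        rw [← e2]
        rw [← e1] at h2
        obtain ⟨t, ht⟩ := Nat.exists_eq_succ_of_ne_zero hj
        rw [ht] at h2 ⊢
        simp only [Nat.succ_eq_add_one, Nat.add_sub_cancel] at h2 ⊢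
        nlinarith [Nat.zero_le (t * ∏ i ∈ Finset.univ.erase j, (1 + N i))]
      obtain ⟨N', h1, h3, h4⟩ := ih _ hlt M rfl hMq
      exact ⟨N', fun i => (h1 i).trans (hMle i), h3, h4⟩

lemma from_dual {m : ℕ} (hm : 1 ≤ m) (α : Fin m → ℝ) (c : ℝ) (hc : 0 < c)
    (h : ∀ n : Fin m → ℤ, n ≠ 0 →
      c / ∏ i, (1 + |(n i : ℝ)|) < distInt (∑ i, (n i : ℝ) * α i)) (hpos : ∀ q : ℕ, 1 ≤ q →
        ∀ i, 0 < distInt (q * α i)) :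
    ∀ q : ℕ, 1 ≤ q → (c / (2 * m)) ^ m ≤ q * ∏ i, distInt (q * α i) := by
  classical
  intro q hq
  have hm' : (1 : ℝ) ≤ m := by exact_mod_cast hm
  have hq' : (1 : ℝ) ≤ q := by exact_mod_cast hq
  by_contra hcon
  push Not at hcon
  set T := c / (2 * m) with hT
  have hTpos : 0 < T := by positivity
  set δ : Fin m → ℝ := fun i => distInt (q * α i) with hδ
  have hδpos : ∀ i, 0 < δ i := hpos q hq
  have hprodpos : 0 < ∏ i, δ i := Finset.prod_pos fun i _ => hδpos i
  have hbig : q < ∏ i, (1 + ⌊T / δ i⌋₊) := by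
    have h1 : T ^ m / ∏ i, δ i ≤ ∏ i, (1 + (⌊T / δ i⌋₊ : ℝ)) := by
      have : T ^ m / ∏ i, δ i = ∏ i, (T / δ i) := by
        rw [Finset.prod_div_distrib]; simp
      rw [this]
      refine Finset.prod_le_prod (fun i _ => (div_pos hTpos (hδpos i)).le) fun i _ => ?_
      have := Nat.lt_floor_add_one (T / δ i)
      linarith
    have h2 : (q : ℝ) < T ^ m / ∏ i, δ i := by rwa [lt_div_iff₀ hprodpos]
    have := h2.trans_le h1
    exact_mod_cast this
  obtain ⟨N, hN1, hN2, hN3⟩ := shrink_box q hq _ _ rfl hbig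
  have hNδ : ∀ i, N i * δ i ≤ T := by
    intro i
    have h1 : (N i : ℝ) ≤ ⌊T / δ i⌋₊ := by exact_mod_cast hN1 i
    have h2 := Nat.floor_le (div_pos hTpos (hδpos i)).le
    have := h1.trans h2
    rwa [le_div_iff₀ (hδpos i)] at this
  haveI : NeZero q := ⟨by omega⟩
  let p : Fin m → ℤ := fun i => round (q * α i)
  let g : (Fin m → ℕ) → ZMod q := fun n => ((∑ i, (n i : ℤ) * p i : ℤ) : ZMod q)
  have hcard : (Finset.univ : Finset (ZMod q)).card <
      (Fintype.piFinset (fun i => Finset.range (1 + N i))).card := by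
    rw [Fintype.card_piFinset, Finset.card_univ, ZMod.card]
    simpa using hN2
  obtain ⟨u, hu, v, hv, huv, he⟩ := Finset.exists_ne_map_eq_of_card_lt_of_maps_to hcard
    (f := g) (fun _ _ => Finset.mem_coe.2 (Finset.mem_univ _))
  rw [Fintype.mem_piFinset] at hu hv
  let n : Fin m → ℤ := fun i => (u i : ℤ) - v i
  have hn : n ≠ 0 := by
    intro h0
    apply huv
    funext i
    have := congrFun h0 i
    simp only [n, Pi.zero_apply] at this
    omega
  have hnN : ∀ i, |(n i : ℝ)| ≤ N i := by
    intro i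
    have h1 := Finset.mem_range.1 (hu i)
    have h2 := Finset.mem_range.1 (hv i)
    have : |n i| ≤ (N i : ℤ) := by
      rw [abs_le]; simp only [n]; omega
    exact_mod_cast this
  have hdvd : (q : ℤ) ∣ ∑ i, n i * p i := by
    have := (ZMod.intCast_eq_intCast_iff_dvd_sub _ _ _).1 he.symm
    have e : ∑ i, n i * p i = ∑ i, (u i : ℤ) * p i - ∑ i, (v i : ℤ) * p i := by
      rw [← Finset.sum_sub_distrib]
      exact Finset.sum_congr rfl fun i _ => by simp only [n]; ring
    rw [e]; exact this
  obtain ⟨r, hr⟩ := hdvd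
  have hr' : ∑ i, (n i : ℝ) * p i = q * r := by exact_mod_cast hr
  have hdist : q * distInt (∑ i, (n i : ℝ) * α i) ≤ m * T := by
    have h1 := dI_le (∑ i, (n i : ℝ) * α i) r
    have h2 : (q : ℝ) * |∑ i, (n i : ℝ) * α i - r| = |∑ i, (n i : ℝ) * (q * α i - p i)| := by
      rw [← Nat.abs_cast q, ← abs_mul]
      congr 1
      rw [Nat.abs_cast, mul_sub, ← hr', Finset.mul_sum, ← Finset.sum_sub_distrib]
      exact Finset.sum_congr rfl fun i _ => by ring
    have h3 : |∑ i, (n i : ℝ) * (q * α i - p i)| ≤ ∑ i : Fin m, T := by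
      refine (Finset.abs_sum_le_sum_abs _ _).trans (Finset.sum_le_sum fun i _ => ?_)
      rw [abs_mul]
      exact (mul_le_mul_of_nonneg_right (hnN i) (abs_nonneg _)).trans (hNδ i)
    simp only [Finset.sum_const, Finset.card_univ, Fintype.card_fin, nsmul_eq_mul] at h3
    calc q * distInt (∑ i, (n i : ℝ) * α i) ≤ q * |∑ i, (n i : ℝ) * α i - r| :=
          mul_le_mul_of_nonneg_left h1 (by linarith)
      _ ≤ m * T := by rw [h2]; exact h3
  have hNprod : ∏ i, (1 + |(n i : ℝ)|) ≤ 2 * q := by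
    calc ∏ i, (1 + |(n i : ℝ)|) ≤ ∏ i, (1 + (N i : ℝ)) :=
          Finset.prod_le_prod (fun i _ => by positivity) fun i _ => by linarith [hnN i]
      _ ≤ 2 * q := by exact_mod_cast hN3
  have hpp : 0 < ∏ i, (1 + |(n i : ℝ)|) := Finset.prod_pos fun i _ => by positivity
  have hfin := h n hn
  rw [div_lt_iff₀ hpp] at hfin
  have h5 := mul_le_mul_of_nonneg_left hNprod (dI_nonneg (∑ i, (n i : ℝ) * α i))
  have h6 : 2 * (m * T) = c := by rw [hT]; field_simp
  nlinarith

/-- For `m ≥ 1` and `α₁,…,α_m ∈ ℝ`, one has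
`liminf_{n→∞} n‖nα₁‖⋯‖nα_m‖ > 0` if and only if there is `c > 0` such that for every
nonzero `n ∈ ℤ^m`, `‖n₁α₁ + ⋯ + n_mα_m‖ > c/((1+|n₁|)⋯(1+|n_m|))`. -/
theorem liminf_pos_iff_dual_form (m : ℕ) (hm : 1 ≤ m) (α : Fin m → ℝ) :
    (0 < Filter.liminf
      (fun n : ℕ => (n : ℝ) * ∏ i, distInt ((n : ℝ) * α i)) Filter.atTop) ↔
    (∃ c > (0 : ℝ), ∀ n : Fin m → ℤ, n ≠ 0 →
      c / ∏ i, (1 + |(n i : ℝ)|) < distInt (∑ i, (n i : ℝ) * α i)) := by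
  classical
  have hnn : ∀ n : ℕ, 0 ≤ (n : ℝ) * ∏ i, distInt ((n : ℝ) * α i) := fun n =>
    mul_nonneg (Nat.cast_nonneg _) (Finset.prod_nonneg fun i _ => dI_nonneg _)
  constructor
  · intro hl
    obtain ⟨c, hc, hcl⟩ := exists_between hl
    have hev := Filter.eventually_lt_of_lt_liminf hcl
      (Filter.isBoundedUnder_of ⟨0, fun n => hnn n⟩)
    obtain ⟨N0, hN0⟩ := Filter.eventually_atTop.1 hev
    have hk : (0 : ℝ) < (N0 + 1 : ℕ) := by positivity
    refine to_dual hm α (c / ((N0 + 1 : ℕ) : ℝ) ^ (m + 1)) (by positivity) fun q hq => ?_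
    rw [div_le_iff₀ (by positivity)]
    have h1 := hN0 ((N0 + 1) * q) (by nlinarith)
    refine h1.le.trans ?_
    have h2 : ∏ i, distInt ((((N0 + 1) * q : ℕ) : ℝ) * α i) ≤
        ∏ i, (((N0 + 1 : ℕ) : ℝ) * distInt (q * α i)) := by
      refine Finset.prod_le_prod (fun i _ => dI_nonneg _) fun i _ => ?_
      have := dI_mul (N0 + 1) (q * α i)
      rwa [← mul_assoc, ← Nat.cast_mul] at this
    rw [Finset.prod_mul_distrib] at h2
    simp only [Finset.prod_const, Finset.card_univ, Fintype.card_fin] at h2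
    refine (mul_le_mul_of_nonneg_left h2 (Nat.cast_nonneg _)).trans (le_of_eq ?_)
    rw [Nat.cast_mul]
    ring
  · rintro ⟨c, hc, h⟩
    have hsingle : ∀ q : ℕ, 1 ≤ q → ∀ i, c / (1 + q) < distInt (q * α i) := by
      intro q hq i
      have h1 := h (Pi.single i (q : ℤ)) (by
        rw [Ne, Pi.single_eq_zero_iff]; omega)
      have e1 : ∏ k, (1 + |((Pi.single i (q : ℤ) : Fin m → ℤ) k : ℝ)|) = 1 + q := by
        rw [Finset.prod_eq_single i]
        · simp
        · intro b _ hb; simp [hb]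
        · simp
      have e2 : ∑ k, ((Pi.single i (q : ℤ) : Fin m → ℤ) k : ℝ) * α k = q * α i := by
        rw [Finset.sum_eq_single i]
        · simp
        · intro b _ hb; simp [hb]
        · simp
      rwa [e1, e2] at h1
    have hlow := from_dual hm α c hc h
      (fun q hq i => lt_of_le_of_lt (by positivity) (hsingle q hq i))
    have hm0 : (0 : ℝ) < m := by exact_mod_cast hm
    have hfreq : ∃ᶠ n : ℕ in Filter.atTop, (n : ℝ) * ∏ i, distInt ((n : ℝ) * α i) ≤ 1 := by
      rw [Filter.frequently_atTop]
      intro N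
      obtain ⟨K, hK⟩ := exists_nat_gt ((1 + N : ℝ) / c)
      have hK0 : (0 : ℝ) < K := lt_of_le_of_lt (by positivity) hK
      have hKn : 0 < K := by exact_mod_cast hK0
      let j : Fin m := ⟨0, hm⟩
      obtain ⟨q, hq1, hq2, hq3⟩ := dirichlet_box α (fun i => if i = j then K else 1)
        (fun i => by split_ifs <;> omega)
      rw [Finset.prod_ite_eq'] at hq2
      simp only [Finset.mem_univ, if_true] at hq2
      have hj := hq3 j
      simp only [if_true] at hj
      refine ⟨q, ?_, ?_⟩
      · by_contra hlt
        push Not at hlt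
        have h1 := hsingle q hq1 j
        have h2 : (q : ℝ) ≤ N := by exact_mod_cast hlt.le
        have h3 := h1.trans_le hj
        rw [div_lt_div_iff₀ (by positivity) hK0] at h3
        rw [div_lt_iff₀ hc] at hK
        nlinarith
      · have h1 : ∏ i, distInt ((q : ℝ) * α i) ≤ 1 / K := by
          rw [← Finset.mul_prod_erase Finset.univ _ (Finset.mem_univ j)]
          have := Finset.prod_le_one (s := Finset.univ.erase j)
            (f := fun i => distInt ((q : ℝ) * α i))
            (fun i _ => dI_nonneg _) (fun i _ => dI_le_one _)
          exact (mul_le_of_le_one_right (dI_nonneg _) this).trans hj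
        have h2 : (q : ℝ) ≤ K := by exact_mod_cast hq2
        calc (q : ℝ) * ∏ i, distInt ((q : ℝ) * α i) ≤ K * (1 / K) :=
              mul_le_mul h2 h1 (Finset.prod_nonneg fun i _ => dI_nonneg _) hK0.le
          _ = 1 := by field_simp
    have hle : (c / (2 * m)) ^ m ≤ Filter.liminf
      (fun n : ℕ => (n : ℝ) * ∏ i, distInt ((n : ℝ) * α i)) Filter.atTop := by
      refine Filter.le_liminf_of_le (Filter.IsCoboundedUnder.of_frequently_le hfreq) ?_
      filter_upwards [Filter.eventually_ge_atTop 1] with q hq using hlow q hq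
    exact lt_of_lt_of_le (by positivity) hle
end
end

section
/- Let d ≥ 2 and let α₁,…,α_d ∈ ℝ be such that 1, α₁,…,α_d are linearly independent over ℚ. Then the set of real numbers {a₁α₁ + ⋯ + a_dα_d : a ∈ ℤ^d, gcd(a₁,…,a_d) = 1} is dense modulo 1, i.e. its image in ℝ/ℤ is dense. -/
noncomputable section

open MeasureTheory Set Filter

/-- For `d ≥ 2` and `α₁,…,α_d ∈ ℝ` with `1, α₁,…,α_d` linearly
independent over `ℚ`, the set `{a₁α₁ + ⋯ + a_dα_d : a ∈ ℤ^d, gcd(a₁,…,a_d) = 1}`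
is dense modulo `1`. -/
theorem dense_mod_one_of_coprime_combinations (d : ℕ) (hd : 2 ≤ d) (α : Fin d → ℝ)
    (hli : LinearIndependent ℚ (Fin.cons (1 : ℝ) α : Fin (d + 1) → ℝ)) :
    Dense {t : AddCircle (1 : ℝ) | ∃ a : Fin d → ℤ,
      Finset.univ.gcd a = 1 ∧ t = ((∑ i, (a i : ℝ) * α i : ℝ) : AddCircle (1 : ℝ))} := by
  have hirr : Irrational (α ⟨1, by omega⟩) := by
    rintro ⟨q, hq⟩
    have h := (LinearIndependent.pair_iff.mp (hli.comp ![0, Fin.succ ⟨1, by omega⟩] (by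
      intro i j hij
      fin_cases i <;> fin_cases j <;> simp_all [Fin.ext_iff]) |> fun h => by
        have e : (Fin.cons (1 : ℝ) α : Fin (d + 1) → ℝ) ∘ ![0, Fin.succ ⟨1, by omega⟩]
          = ![1, α ⟨1, by omega⟩] := by
          funext i
          fin_cases i <;> rfl
        rw [e] at h
        exact h)) (-q) 1 (by simp [Rat.smul_def, ← hq])
    exact one_ne_zero h.2
  have hD : Dense (AddSubgroup.zmultiples
      ((α ⟨1, by omega⟩ : ℝ) : AddCircle (1 : ℝ)) : Set (AddCircle (1 : ℝ))) := by
    rw [AddSubgroup.coe_zmultiples, ← DenseRange, AddCircle.denseRange_zsmul_coe_iff]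
    simpa using hirr
  have hT := (Homeomorph.addLeft ((α ⟨0, by omega⟩ : ℝ) : AddCircle (1 : ℝ))).surjective.denseRange.dense_image
    (Homeomorph.addLeft ((α ⟨0, by omega⟩ : ℝ) : AddCircle (1 : ℝ))).continuous hD
  refine hT.mono ?_
  rintro _ ⟨_, ⟨n, rfl⟩, rfl⟩
  refine ⟨Pi.single ⟨0, by omega⟩ (1 : ℤ) + Pi.single ⟨1, by omega⟩ (n : ℤ), ?_, ?_⟩
  · have h1 : Finset.univ.gcd (Pi.single (⟨0, by omega⟩ : Fin d) (1 : ℤ)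
        + Pi.single (⟨1, by omega⟩ : Fin d) n : Fin d → ℤ) ∣ (1 : ℤ) := by
      have := Finset.gcd_dvd (f := (Pi.single (⟨0, by omega⟩ : Fin d) (1 : ℤ)
        + Pi.single (⟨1, by omega⟩ : Fin d) n : Fin d → ℤ)) (Finset.mem_univ (⟨0, by omega⟩ : Fin d))
      simpa [Pi.single_apply] using this
    have h2 := Finset.normalize_gcd (s := Finset.univ) (f := (Pi.single (⟨0, by omega⟩ : Fin d) (1 : ℤ)
        + Pi.single (⟨1, by omega⟩ : Fin d) n : Fin d → ℤ))
    rw [← h2]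
    exact normalize_eq_one.mpr (isUnit_of_dvd_one h1)
  · simp [Pi.single_apply, add_mul, Finset.sum_add_distrib, ite_mul]
end
end
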